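/- Let K be a field of characteristic 0 and let S = K[x_1,…,x_11]. Let I(G_{w_2}) be the ideal generated by x_1^2x_3^2, x_1^2x_4^2, x_1^2x_7^2, x_1^2x_10^2, x_1^2x_11^2, x_2^2x_4^2, x_2^2x_5^2, x_2^2x_8^2, x_2^2x_10^2, x_2^2x_11^2, x_3^2x_5^2, x_3^2x_6^2, x_3^2x_8^2, x_3^2x_11^2, x_4^2x_6^2, x_4^2x_9^2, x_4^2x_11^2, x_5^2x_7^2, x_5^2x_9^2, x_5^2x_11^2, x_6^2x_8^2, x_6^2x_9^2, x_7^2x_9^2, x_7^2x_10^2, x_8x_10. Then I(G_{w_2}) is unmixed and S/I(G_{w_2}) satisfies Serre's condition (S_2), but S/I(G_{w_2}) is not Cohen-Macaulay. -/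

import Mathlib

universe u

/-- The height of an ideal `p` (intended: a prime ideal), i.e. the Krull dimension of the
set of prime ideals contained in `p`. -/
noncomputable def idealHeight {R : Type*} [CommRing R] (p : Ideal R) : WithBot ℕ∞ :=
  Order.krullDim {q : PrimeSpectrum R // q.asIdeal ≤ p}

/-- An ideal `I ⊆ R` is unmixed if all associated primes of `R ⧸ I` have the same height. -/
def IsUnmixedIdeal {R : Type*} [CommRing R] (I : Ideal R) : Prop :=
  ∀ p ∈ associatedPrimes R (R ⧸ I), ∀ q ∈ associatedPrimes R (R ⧸ I),
    idealHeight p = idealHeight q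

open CategoryTheory in
/-- The Ext module `Ext_R^n(M, N)`. -/
noncomputable def ExtMod (R : Type u) [CommRing R] (n : ℕ) (M N : Type u)
    [AddCommGroup M] [Module R M] [AddCommGroup N] [Module R N] : ModuleCat R :=
  ((Ext R (ModuleCat R) n).obj (Opposite.op (ModuleCat.of R M))).obj (ModuleCat.of R N)

/-- The depth of a local ring `R`, defined via vanishing of the Ext modules
`Ext_R^n(k, R)`, where `k` is the residue field of `R`. -/
noncomputable def localRingDepth (R : Type u) [CommRing R] [IsLocalRing R] : ℕ∞ :=
  sInf {n : ℕ∞ | ∃ m : ℕ, n = m ∧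
    Nontrivial (ExtMod R m (IsLocalRing.ResidueField R) R)}

/-- A commutative ring is Cohen-Macaulay if for every maximal ideal `p`, the depth of the
localization at `p` equals its Krull dimension. -/
def IsCohenMacaulayRing (R : Type u) [CommRing R] : Prop :=
  ∀ (p : Ideal R) [p.IsMaximal],
    (localRingDepth (Localization.AtPrime p) : WithBot ℕ∞) =
      ringKrullDim (Localization.AtPrime p)

/-- Serre's condition `(S_k)` for a commutative ring: for every prime ideal `p`, the depth
of the localization at `p` is at least the minimum of its Krull dimension and `k`. -/
def SerreCondition (k : ℕ) (R : Type u) [CommRing R] : Prop :=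
  ∀ (p : Ideal R) [p.IsPrime],
    min (ringKrullDim (Localization.AtPrime p)) (k : WithBot ℕ∞) ≤
      (localRingDepth (Localization.AtPrime p) : WithBot ℕ∞)

set_option maxHeartbeats 1000000

open MvPolynomial in
/-- The edge-weighted edge ideal `I(G_{w₂})` of the graph `G` coming from a triangulation
of the real projective plane, with weight `1` on the edge `x_8 x_10` and weight `2` on all
other edges. -/
noncomputable def weightedIdealGw2 (K : Type u) [Field K] :
    Ideal (MvPolynomial (Fin 11) K) :=
  Ideal.span ({X 0 ^ 2 * X 2 ^ 2,
    X 0 ^ 2 * X 3 ^ 2,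
    X 0 ^ 2 * X 6 ^ 2,
    X 0 ^ 2 * X 9 ^ 2,
    X 0 ^ 2 * X 10 ^ 2,
    X 1 ^ 2 * X 3 ^ 2,
    X 1 ^ 2 * X 4 ^ 2,
    X 1 ^ 2 * X 7 ^ 2,
    X 1 ^ 2 * X 9 ^ 2,
    X 1 ^ 2 * X 10 ^ 2,
    X 2 ^ 2 * X 4 ^ 2,
    X 2 ^ 2 * X 5 ^ 2,
    X 2 ^ 2 * X 7 ^ 2,
    X 2 ^ 2 * X 10 ^ 2,
    X 3 ^ 2 * X 5 ^ 2,
    X 3 ^ 2 * X 8 ^ 2,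
    X 3 ^ 2 * X 10 ^ 2,
    X 4 ^ 2 * X 6 ^ 2,
    X 4 ^ 2 * X 8 ^ 2,
    X 4 ^ 2 * X 10 ^ 2,
    X 5 ^ 2 * X 7 ^ 2,
    X 5 ^ 2 * X 8 ^ 2,
    X 6 ^ 2 * X 8 ^ 2,
    X 6 ^ 2 * X 9 ^ 2,
    X 7 * X 9} : Set (MvPolynomial (Fin 11) K))

section ExtComparison

open CategoryTheory Limits

variable {R : Type u} [CommRing R]

theorem subsingleton_functorExt_succ_iff {X Y : ModuleCat.{u} R} (n : ℕ) :
    Subsingleton (((Ext R (ModuleCat R) (n + 1)).obj (Opposite.op X)).obj Y) ↔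
      Subsingleton (Abelian.Ext.{u} X Y (n + 1)) := by
  let P := projectiveResolution X
  rw [← ModuleCat.isZero_iff_subsingleton, (P.isoExt (n + 1) Y).isZero_iff,
    ← HomologicalComplex.exactAt_iff_isZero_homology,
    HomologicalComplex.exactAt_iff' _ n (n + 1) (n + 2) (by simp) (by simp),
    ShortComplex.moduleCat_exact_iff]
  constructor
  · intro h
    refine subsingleton_of_forall_eq 0 fun α ↦ ?_
    obtain ⟨f, hf, rfl⟩ := P.extMk_surjective α (n + 2) rfl
    rw [P.extMk_eq_zero_iff _ _ _ _ n rfl]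
    exact h f hf
  · intro h f hf
    exact (P.extMk_eq_zero_iff (n := n + 1) f (n + 2) rfl hf n rfl).1 (Subsingleton.elim _ _)

theorem subsingleton_functorExt_zero {X Y : ModuleCat.{u} R} (h : Subsingleton (X ⟶ Y)) :
    Subsingleton (((Ext R (ModuleCat R) 0).obj (Opposite.op X)).obj Y) := by
  let P := projectiveResolution X
  rw [← ModuleCat.isZero_iff_subsingleton, (P.isoExt 0 Y).isZero_iff,
    ← HomologicalComplex.exactAt_iff_isZero_homology,
    HomologicalComplex.exactAt_iff' _ 0 0 1 (by simp) (by simp),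
    ShortComplex.moduleCat_exact_iff]
  intro f hf
  obtain ⟨g, hg⟩ := CokernelCofork.IsColimit.desc' P.isColimitCokernelCofork
    (W := Y) f hf
  refine ⟨0, ?_⟩
  have hg' : g = 0 := h.elim g 0
  rw [map_zero, ← hg, hg', comp_zero]
  rfl

theorem subsingleton_ext_one_of_shortExact {S : ShortComplex (ModuleCat.{u} R)}
    (hS : S.ShortExact) [Projective S.X₂] {Y : ModuleCat.{u} R}
    (h : ∀ φ : S.X₁ ⟶ Y, ∃ ψ : S.X₂ ⟶ Y, S.f ≫ ψ = φ) :
    Subsingleton (Abelian.Ext.{u} S.X₃ Y 1) := by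
  refine subsingleton_of_forall_eq 0 fun x ↦ ?_
  obtain ⟨y, hy⟩ := Abelian.Ext.contravariant_sequence_exact₃ hS Y x
    (Abelian.Ext.eq_zero_of_projective _) (n₀ := 0) rfl
  obtain ⟨φ, rfl⟩ := Abelian.Ext.homEquiv₀.symm.surjective y
  obtain ⟨ψ, rfl⟩ := h φ
  rw [← hy, Abelian.Ext.homEquiv₀_symm_apply, ← Abelian.Ext.mk₀_comp_mk₀,
    ← Abelian.Ext.comp_assoc _ _ _ rfl rfl rfl, hS.extClass_comp, Abelian.Ext.zero_comp]

theorem subsingleton_ext_one_left_of_shortExact {S : ShortComplex (ModuleCat.{u} R)}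
    (hS : S.ShortExact) [Projective S.X₂] {Y : ModuleCat.{u} R}
    (h : Subsingleton (Abelian.Ext.{u} S.X₃ Y 2)) :
    Subsingleton (Abelian.Ext.{u} S.X₁ Y 1) := by
  refine subsingleton_of_forall_eq 0 fun y ↦ ?_
  obtain ⟨z, rfl⟩ := Abelian.Ext.contravariant_sequence_exact₁ hS Y y (n₁ := 2) rfl
    (Subsingleton.elim _ _)
  rw [Abelian.Ext.eq_zero_of_projective z, Abelian.Ext.comp_zero]

theorem exists_lift_of_shortExact {S : ShortComplex (ModuleCat.{u} R)}
    (hS : S.ShortExact) {X : ModuleCat.{u} R} (h : Subsingleton (Abelian.Ext.{u} X S.X₁ 1))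
    (φ : X ⟶ S.X₃) : ∃ ψ : X ⟶ S.X₂, ψ ≫ S.g = φ := by
  obtain ⟨y, hy⟩ := Abelian.Ext.covariant_sequence_exact₃ X hS
    (Abelian.Ext.mk₀ φ) (n₁ := 1) rfl (Subsingleton.elim _ _)
  obtain ⟨ψ, rfl⟩ := Abelian.Ext.homEquiv₀.symm.surjective y
  rw [Abelian.Ext.homEquiv₀_symm_apply, Abelian.Ext.mk₀_comp_mk₀] at hy
  exact ⟨ψ, Abelian.Ext.homEquiv₀.symm.injective hy⟩

theorem shortExact_moduleCat {M N P : Type u} [AddCommGroup M] [Module R M]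
    [AddCommGroup N] [Module R N] [AddCommGroup P] [Module R P]
    (f : M →ₗ[R] N) (g : N →ₗ[R] P) (hf : Function.Injective f) (hg : Function.Surjective g)
    (hfg : Function.Exact f g) :
    (ShortComplex.mk (ModuleCat.ofHom f) (ModuleCat.ofHom g)
      (ModuleCat.hom_ext (LinearMap.ext hfg.apply_apply_eq_zero))).ShortExact :=
  { exact := (ShortComplex.moduleCat_exact_iff _).2 fun x hx ↦ (hfg x).1 hx
    mono_f := (ModuleCat.mono_iff_injective _).2 hf
    epi_g := (ModuleCat.epi_iff_surjective _).2 hg }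

theorem subsingleton_extMod_succ_iff {M N : Type u} [AddCommGroup M] [Module R M]
    [AddCommGroup N] [Module R N] (n : ℕ) :
    Subsingleton (ExtMod R (n + 1) M N) ↔
      Subsingleton (Abelian.Ext.{u} (ModuleCat.of R M) (ModuleCat.of R N) (n + 1)) :=
  subsingleton_functorExt_succ_iff n

theorem subsingleton_extMod_zero {M N : Type u} [AddCommGroup M] [Module R M]
    [AddCommGroup N] [Module R N] (h : Subsingleton (M →ₗ[R] N)) :
    Subsingleton (ExtMod R 0 M N) :=
  subsingleton_functorExt_zero (ModuleCat.homEquiv (M := .of R M) (N := .of R N)).subsingleton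

end ExtComparison

section LocalRing

open CategoryTheory IsLocalRing

variable {A : Type u} [CommRing A] [IsLocalRing A]

theorem subsingleton_extMod_zero_residueField
    (h : ∀ x : A, (∀ r ∈ maximalIdeal A, r * x = 0) → x = 0) :
    Subsingleton (ExtMod A 0 (ResidueField A) A) := by
  refine subsingleton_extMod_zero (subsingleton_of_forall_eq 0 fun f ↦ ?_)
  ext y
  obtain ⟨y, rfl⟩ := residue_surjective y
  refine h _ fun r hr ↦ ?_
  rw [← smul_eq_mul, ← map_smul, Algebra.smul_def, ResidueField.algebraMap_eq,
    (residue_eq_zero_iff r).2 hr, zero_mul, map_zero]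

variable (A) in
theorem exact_maximalIdeal_subtype :
    Function.Exact (maximalIdeal A).subtype (Algebra.linearMap A (ResidueField A)) := fun x ↦ by
  rw [Algebra.linearMap_apply, ResidueField.algebraMap_eq, residue_eq_zero_iff]
  exact ⟨fun h ↦ ⟨⟨x, h⟩, rfl⟩, by rintro ⟨y, rfl⟩; exact y.2⟩

theorem subsingleton_extMod_one_residueField
    (h : ∀ φ : maximalIdeal A →ₗ[A] A, ∃ a : A, ∀ r, φ r = r * a) :
    Subsingleton (ExtMod A 1 (ResidueField A) A) := by
  rw [subsingleton_extMod_succ_iff 0]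
  refine subsingleton_ext_one_of_shortExact (shortExact_moduleCat _ _ Subtype.val_injective
    residue_surjective (exact_maximalIdeal_subtype A)) fun φ ↦ ?_
  obtain ⟨a, ha⟩ := h φ.hom
  exact ⟨ModuleCat.ofHom (LinearMap.toSpanSingleton A A a),
    ModuleCat.hom_ext (LinearMap.ext fun r ↦ (ha r).symm)⟩

theorem exists_lift_of_subsingleton_extMod_two
    (h : Subsingleton (ExtMod A 2 (ResidueField A) A))
    {E C : Type u} [AddCommGroup E] [Module A E] [AddCommGroup C] [Module A C]
    (f : A →ₗ[A] E) (g : E →ₗ[A] C) (hf : Function.Injective f) (hg : Function.Surjective g)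
    (hfg : Function.Exact f g) (φ : maximalIdeal A →ₗ[A] C) :
    ∃ ψ : maximalIdeal A →ₗ[A] E, g ∘ₗ ψ = φ := by
  rw [subsingleton_extMod_succ_iff 1] at h
  obtain ⟨ψ, hψ⟩ := exists_lift_of_shortExact (shortExact_moduleCat f g hf hg hfg)
    (subsingleton_ext_one_left_of_shortExact (shortExact_moduleCat _ _ Subtype.val_injective
      residue_surjective (exact_maximalIdeal_subtype A)) h) (ModuleCat.ofHom φ)
  exact ⟨ψ.hom, congrArg ModuleCat.Hom.hom hψ⟩

end LocalRing

section Gluing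

open IsLocalRing

variable {A : Type u} [CommRing A] {ι : Type*} {Q : ι → Ideal A} {Q₂ : ι → ι → Ideal A}
  {adj : ι → ι → Prop}

/-- The difference map from the product of the quotients by `Q i` to the product of the
quotients by `Q₂ i j` over all related pairs. -/
def differenceMap (Q : ι → Ideal A) (Q₂ : ι → ι → Ideal A) (adj : ι → ι → Prop)
    (h₁ : ∀ i j, Q i ≤ Q₂ i j) (h₂ : ∀ i j, Q j ≤ Q₂ i j) :
    ((i : ι) → A ⧸ Q i) →ₗ[A] ((p : {p : ι × ι // adj p.1 p.2}) → A ⧸ Q₂ p.1.1 p.1.2) :=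
  LinearMap.pi fun p ↦
    (Submodule.factor (h₁ p.1.1 p.1.2)).comp (LinearMap.proj p.1.1) -
    (Submodule.factor (h₂ p.1.1 p.1.2)).comp (LinearMap.proj p.1.2)

theorem differenceMap_eq_iff (h₁ : ∀ i j, Q i ≤ Q₂ i j) (h₂ : ∀ i j, Q j ≤ Q₂ i j)
    (c : ι → A) (t : ι → ι → A) :
    differenceMap Q Q₂ adj h₁ h₂ (fun i ↦ Ideal.Quotient.mk (Q i) (c i)) =
      (fun p ↦ Ideal.Quotient.mk _ (t p.1.1 p.1.2)) ↔
        ∀ i j, adj i j → t i j - (c i - c j) ∈ Q₂ i j := by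
  have h (p : {p : ι × ι // adj p.1 p.2}) :
      differenceMap Q Q₂ adj h₁ h₂ (fun i ↦ Ideal.Quotient.mk (Q i) (c i)) p =
        Ideal.Quotient.mk _ (c p.1.1 - c p.1.2) := rfl
  simp only [funext_iff, h, Ideal.Quotient.eq, Subtype.forall, Prod.forall]
  refine forall₃_congr fun i j _ ↦ ?_
  rw [← neg_mem_iff, neg_sub]

theorem exact_differenceMap (h₁ : ∀ i j, Q i ≤ Q₂ i j) (h₂ : ∀ i j, Q j ≤ Q₂ i j)
    (hglue : ∀ e : ι → A, (∀ i j, adj i j → e i - e j ∈ Q₂ i j) → ∃ a, ∀ i, a - e i ∈ Q i) :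
    Function.Exact (LinearMap.pi fun i ↦ (Q i).mkQ : A →ₗ[A] ((i : ι) → A ⧸ Q i))
      (differenceMap Q Q₂ adj h₁ h₂) := by
  intro x
  constructor
  · intro hx
    choose e he using fun i ↦ Ideal.Quotient.mk_surjective (x i)
    obtain rfl : (fun i ↦ Ideal.Quotient.mk (Q i) (e i)) = x := funext he
    have h := (differenceMap_eq_iff h₁ h₂ e 0).1 (hx.trans (funext fun p ↦ (map_zero _).symm))
    obtain ⟨a, ha⟩ := hglue e fun i j hij ↦ by
      rw [← neg_mem_iff, ← zero_sub]
      exact h i j hij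
    exact ⟨a, funext fun i ↦ Ideal.Quotient.eq.2 (ha i)⟩
  · rintro ⟨a, rfl⟩
    refine ((differenceMap_eq_iff h₁ h₂ (fun _ ↦ a) 0).2 fun i j _ ↦ ?_).trans
      (funext fun p ↦ map_zero _)
    simp

variable [IsLocalRing A]

theorem exists_eq_mul_of_regular_pair {Q : Ideal A} {f g : A} (hf : f ∈ maximalIdeal A)
    (hg : g ∈ maximalIdeal A) (hfQ : ∀ a, f * a ∈ Q → a ∈ Q)
    (hgQ : ∀ a, g * a ∈ Q ⊔ Ideal.span {f} → a ∈ Q ⊔ Ideal.span {f})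
    (φ : maximalIdeal A →ₗ[A] A ⧸ Q) : ∃ a : A, ∀ r, φ r = Ideal.Quotient.mk Q (r * a) := by
  have key (r s : maximalIdeal A) : (r : A) • φ s = (s : A) • φ r := by
    rw [← map_smul, ← map_smul]
    exact congrArg φ (Subtype.ext (mul_comm _ _))
  have hsmul (r a : A) : r • Ideal.Quotient.mk Q a = Ideal.Quotient.mk Q (r * a) := rfl
  obtain ⟨u, hu⟩ := Ideal.Quotient.mk_surjective (φ ⟨f, hf⟩)
  obtain ⟨v, hv⟩ := Ideal.Quotient.mk_surjective (φ ⟨g, hg⟩)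
  have h1 := key ⟨g, hg⟩ ⟨f, hf⟩
  rw [← hu, ← hv, hsmul, hsmul, Ideal.Quotient.eq] at h1
  have h2 : u ∈ Q ⊔ Ideal.span {f} := by
    refine hgQ u ?_
    rw [← sub_add_cancel (g * u) (f * v)]
    exact Submodule.add_mem_sup h1 (Ideal.mul_mem_right _ _ (Ideal.mem_span_singleton_self f))
  obtain ⟨q, hq, w, hw, rfl⟩ := Submodule.mem_sup.1 h2
  obtain ⟨a, rfl⟩ := Ideal.mem_span_singleton'.1 hw
  refine ⟨a, fun r ↦ ?_⟩
  obtain ⟨b, hb⟩ := Ideal.Quotient.mk_surjective (φ r)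
  have h3 := key r ⟨f, hf⟩
  rw [← hu, ← hb, hsmul, hsmul, Ideal.Quotient.eq] at h3
  rw [← hb, Ideal.Quotient.eq]
  refine hfQ _ ?_
  have h4 := Q.sub_mem (Q.mul_mem_left r.1 hq) h3
  have h5 : f * (b - r * a) = r * q - (r * (q + a * f) - f * b) := by ring
  rw [h5]
  exact h4

theorem exists_eq_mul_of_gluing (hQ : ⨅ i, Q i = ⊥)
    (h₁ : ∀ i j, Q i ≤ Q₂ i j) (h₂ : ∀ i j, Q j ≤ Q₂ i j)
    (hglue : ∀ e : ι → A, (∀ i j, adj i j → e i - e j ∈ Q₂ i j) → ∃ a, ∀ i, a - e i ∈ Q i)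
    (hhom : ∀ i, ∀ φ : maximalIdeal A →ₗ[A] A ⧸ Q i, ∃ a : A, ∀ r,
      φ r = Ideal.Quotient.mk (Q i) (r * a))
    (hdepth : ∀ i j, adj i j → ∀ a, (∀ r ∈ maximalIdeal A, r * a ∈ Q₂ i j) → a ∈ Q₂ i j)
    (φ : maximalIdeal A →ₗ[A] A) : ∃ a : A, ∀ r, φ r = r * a := by
  choose e he using fun i ↦ hhom i ((Submodule.mkQ (Q i)).comp φ)
  replace he (i) (r : maximalIdeal A) : φ r - r * e i ∈ Q i := Ideal.Quotient.eq.1 (he i r)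
  obtain ⟨a, ha⟩ := hglue e fun i j hij ↦ hdepth i j hij _ fun r hr ↦ by
    have h := sub_mem (h₂ i j (he j ⟨r, hr⟩)) (h₁ i j (he i ⟨r, hr⟩))
    rw [show r * (e i - e j) = φ ⟨r, hr⟩ - r * e j - (φ ⟨r, hr⟩ - r * e i) by ring]
    exact h
  refine ⟨a, fun r ↦ sub_eq_zero.1 ?_⟩
  rw [← Ideal.mem_bot, ← hQ, Ideal.mem_iInf]
  intro i
  rw [show φ r - r * a = (φ r - r * e i) - r * (a - e i) by ring]
  exact sub_mem (he i r) (Ideal.mul_mem_left _ _ (ha i))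

theorem exists_lift_smul_of_subsingleton_extMod_two
    (hext : Subsingleton (ExtMod A 2 (ResidueField A) A))
    {E F : Type u} [AddCommGroup E] [Module A E] [AddCommGroup F] [Module A F]
    (α : A →ₗ[A] E) (β : E →ₗ[A] F) (hα : Function.Injective α) (h : Function.Exact α β) (t : F)
    (ht : ∀ r ∈ maximalIdeal A, ∃ e, β e = r • t) :
    ∃ ψ : maximalIdeal A →ₗ[A] E, ∀ r, β (ψ r) = (r : A) • t := by
  obtain ⟨ψ, hψ⟩ := exists_lift_of_subsingleton_extMod_two hext α β.rangeRestrict hα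
    β.surjective_rangeRestrict
    (fun x ↦ by rw [← h x, ← LinearMap.mem_ker, LinearMap.ker_rangeRestrict, LinearMap.mem_ker])
    (((LinearMap.toSpanSingleton A F t).comp (maximalIdeal A).subtype).codRestrict
      (LinearMap.range β) fun r ↦ ht r r.2)
  exact ⟨ψ, fun r ↦ congrArg Subtype.val (LinearMap.congr_fun hψ r)⟩

theorem exists_coboundary_of_subsingleton_extMod_two {ι : Type} {Q : ι → Ideal A}
    {Q₂ : ι → ι → Ideal A} {adj : ι → ι → Prop} (hQ : ⨅ i, Q i = ⊥)
    (h₁ : ∀ i j, Q i ≤ Q₂ i j) (h₂ : ∀ i j, Q j ≤ Q₂ i j)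
    (hglue : ∀ e : ι → A, (∀ i j, adj i j → e i - e j ∈ Q₂ i j) → ∃ a, ∀ i, a - e i ∈ Q i)
    (hhom : ∀ i, ∀ φ : maximalIdeal A →ₗ[A] A ⧸ Q i, ∃ a : A, ∀ r,
      φ r = Ideal.Quotient.mk (Q i) (r * a))
    (hdepth : ∀ i j, adj i j → ∀ a, (∀ r ∈ maximalIdeal A, r * a ∈ Q₂ i j) → a ∈ Q₂ i j)
    (hext : Subsingleton (ExtMod A 2 (ResidueField A) A)) (t : ι → ι → A)
    (ht : ∀ r ∈ maximalIdeal A, ∃ c : ι → A,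
      ∀ i j, adj i j → r * t i j - (c i - c j) ∈ Q₂ i j) :
    ∃ e : ι → A, ∀ i j, adj i j → t i j - (e i - e j) ∈ Q₂ i j := by
  obtain ⟨ψ, hψ⟩ := exists_lift_smul_of_subsingleton_extMod_two hext _ _
    (fun a b hab ↦ by
      rw [← sub_eq_zero, ← Ideal.mem_bot, ← hQ, Ideal.mem_iInf]
      exact fun i ↦ Ideal.Quotient.eq.1 (congrFun hab i))
    (exact_differenceMap (adj := adj) h₁ h₂ hglue) (fun p ↦ Ideal.Quotient.mk _ (t p.1.1 p.1.2))
    fun r hr ↦ by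
      obtain ⟨c, hc⟩ := ht r hr
      exact ⟨_, (differenceMap_eq_iff h₁ h₂ c fun i j ↦ r * t i j).2 hc⟩
  choose e he using fun i ↦ hhom i ((LinearMap.proj i).comp ψ)
  refine ⟨e, fun i j hij ↦ hdepth i j hij _ fun r hr ↦ ?_⟩
  have h3 : ψ ⟨r, hr⟩ = fun i ↦ Ideal.Quotient.mk (Q i) (r * e i) :=
    funext fun i ↦ he i ⟨r, hr⟩
  have h4 := hψ ⟨r, hr⟩
  rw [h3] at h4
  have h5 := (differenceMap_eq_iff h₁ h₂ (fun i ↦ r * e i) fun i j ↦ r * t i j).1 h4 i j hij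
  rwa [mul_sub, mul_sub]

end Gluing

section StandardMonomials

open MvPolynomial

variable {σ K : Type*} [Field K]

variable (K) in
/-- The monomial ideal whose standard monomials have exponents in the lower set `D`. -/
noncomputable def standardIdeal (D : LowerSet (σ →₀ ℕ)) : Ideal (MvPolynomial σ K) :=
  restrictSupportIdeal K (D : Set (σ →₀ ℕ))ᶜ D.lower.compl

theorem mem_standardIdeal {D : LowerSet (σ →₀ ℕ)} {f : MvPolynomial σ K} :
    f ∈ standardIdeal K D ↔ ∀ a ∈ D, coeff a f = 0 := by
  change (f.support : Set (σ →₀ ℕ)) ⊆ (D : Set (σ →₀ ℕ))ᶜ ↔ _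
  simp only [Set.subset_def, mem_support_iff, Set.mem_compl_iff,
    SetLike.mem_coe]
  exact forall_congr' fun a ↦ not_imp_not

theorem standardIdeal_anti {D D' : LowerSet (σ →₀ ℕ)} (h : D ≤ D') :
    standardIdeal K D' ≤ standardIdeal K D := fun _ hf ↦
  mem_standardIdeal.2 fun a ha ↦ mem_standardIdeal.1 hf a (h ha)

theorem monomial_mem_standardIdeal {D : LowerSet (σ →₀ ℕ)} {a : σ →₀ ℕ} (ha : a ∉ D) (c : K) :
    monomial a c ∈ standardIdeal K D := mem_standardIdeal.2 fun b hb ↦ by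
  classical
  rw [coeff_monomial, if_neg]
  rintro rfl
  exact ha hb

theorem coeff_eq_zero_of_mul {τ T : Type*} [CommRing T] [IsDomain T] (W : LowerSet (τ →₀ ℕ))
    {F H : MvPolynomial τ T} (hF : coeff 0 F ≠ 0) (h : ∀ b ∈ W, coeff b (F * H) = 0) :
    ∀ b ∈ W, coeff b H = 0 := by
  classical
  suffices ∀ n, ∀ b ∈ W, b.degree = n → coeff b H = 0 from fun b hb ↦ this _ b hb rfl
  intro n
  induction n using Nat.strong_induction_on with
  | _ n ih =>
    intro b hb hn
    have h0 := h b hb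
    rw [coeff_mul, Finset.sum_eq_single (0, b)] at h0
    · exact (mul_eq_zero.1 h0).resolve_left hF
    · rintro ⟨x, y⟩ hxy hne
      rw [Finset.HasAntidiagonal.mem_antidiagonal] at hxy
      dsimp only at hxy ⊢
      subst hxy
      rw [ih y.degree _ y (W.lower le_add_self hb) rfl, mul_zero]
      rw [← hn, map_add, lt_add_iff_pos_left, pos_iff_ne_zero, Ne, Finsupp.degree_eq_zero_iff]
      rintro rfl
      exact hne (by simp)
    · intro hb'
      simp at hb'

variable (K) in
/-- Polynomials regarded as polynomials in the variables satisfying `p`, with coefficients in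
the polynomial ring in the remaining variables. -/
noncomputable def splitEquiv (p : σ → Prop) [DecidablePred p] :
    MvPolynomial σ K ≃ₐ[K] MvPolynomial {v // p v} (MvPolynomial {v // ¬ p v} K) :=
  (renameEquiv K (Equiv.sumCompl p).symm).trans (sumAlgEquiv K _ _)

variable {p : σ → Prop} [DecidablePred p]

theorem sumAlgEquiv_monomial {R S₁ S₂ : Type*} [CommRing R] (a : S₁ ⊕ S₂ →₀ ℕ) (r : R) :
    sumAlgEquiv R S₁ S₂ (monomial a r) =
      monomial (Finsupp.sumFinsuppAddEquivProdFinsupp a).1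
        (monomial (Finsupp.sumFinsuppAddEquivProdFinsupp a).2 r) := by
  simp [sumAlgEquiv, monomial]

theorem splitEquiv_monomial (a : σ →₀ ℕ) (r : K) :
    splitEquiv K p (monomial a r) =
      monomial (a.subtypeDomain p) (monomial (a.subtypeDomain fun v ↦ ¬ p v) r) := by
  rw [splitEquiv, AlgEquiv.trans_apply, renameEquiv_apply, rename_monomial, sumAlgEquiv_monomial,
    ← Finsupp.equivMapDomain_eq_mapDomain]
  congr <;> ext v <;> simp [Finsupp.equivMapDomain_apply]

theorem coeff_splitEquiv (f : MvPolynomial σ K) (a : σ →₀ ℕ) :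
    coeff (a.subtypeDomain fun v ↦ ¬ p v) (coeff (a.subtypeDomain p) (splitEquiv K p f)) =
      coeff a f := by
  classical
  induction f using MvPolynomial.induction_on' with
  | monomial b r =>
    rw [splitEquiv_monomial, coeff_monomial, coeff_monomial]
    by_cases h : b = a
    · subst h
      simp
    · rw [if_neg h]
      split_ifs with h1
      · rw [coeff_monomial, if_neg]
        intro h2
        refine h (Finsupp.ext fun v ↦ ?_)
        by_cases hv : p v
        · exact DFunLike.congr_fun h1 ⟨v, hv⟩
        · exact DFunLike.congr_fun h2 ⟨v, hv⟩
      · exact coeff_zero _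
  | add f g hf hg => rw [map_add, coeff_add, coeff_add, coeff_add, hf, hg]

/-- The ideal generated by the variables satisfying `p`. -/
noncomputable def variableIdeal (K : Type*) [Field K] (p : σ → Prop) : Ideal (MvPolynomial σ K) :=
  Ideal.span (X '' {v | p v})

theorem mem_variableIdeal {f : MvPolynomial σ K} :
    f ∈ variableIdeal K p ↔ coeff 0 (splitEquiv K p f) = 0 := by
  rw [variableIdeal, mem_ideal_span_X_image]
  constructor
  · intro h
    ext c
    rw [coeff_zero]
    have h1 : (Finsupp.piecewise (P := p) 0 c).subtypeDomain p = 0 := by simp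
    have h2 : (Finsupp.piecewise (P := p) 0 c).subtypeDomain (fun v ↦ ¬ p v) = c := by simp
    have h3 := coeff_splitEquiv (p := p) f (Finsupp.piecewise (P := p) 0 c)
    rw [h1, h2] at h3
    rw [h3]
    by_contra h4
    obtain ⟨v, hv, hv'⟩ := h _ (mem_support_iff.2 h4)
    exact hv' (DFunLike.congr_fun h1 ⟨v, hv⟩)
  · intro h a ha
    by_contra! h1
    have h2 : a.subtypeDomain p = 0 := Finsupp.ext fun v ↦ h1 v v.2
    have h3 := coeff_splitEquiv (p := p) f a
    rw [h2, h, coeff_zero] at h3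
    exact mem_support_iff.1 ha h3.symm

/-- Membership in `D` only depends on the exponents of the variables satisfying `p`. -/
def DependsOnVars (p : σ → Prop) (D : LowerSet (σ →₀ ℕ)) : Prop :=
  ∀ ⦃a b : σ →₀ ℕ⦄, (∀ v, p v → a v = b v) → a ∈ D → b ∈ D

/-- The lower set of exponents in the variables satisfying `p` lying in `D`. -/
def restrictLower (p : σ → Prop) [DecidablePred p] (D : LowerSet (σ →₀ ℕ)) :
    LowerSet ({v // p v} →₀ ℕ) where
  carrier := {b | Finsupp.piecewise (P := p) b 0 ∈ D}
  lower' a b hab h := D.lower (fun v ↦ by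
    by_cases hv : p v
    · simpa [Finsupp.piecewise, hv] using hab ⟨v, hv⟩
    · simp [Finsupp.piecewise, hv]) h

theorem mem_standardIdeal_iff_splitEquiv {D : LowerSet (σ →₀ ℕ)} (hD : DependsOnVars p D)
    {f : MvPolynomial σ K} :
    f ∈ standardIdeal K D ↔ ∀ b ∈ restrictLower p D, coeff b (splitEquiv K p f) = 0 := by
  rw [mem_standardIdeal]
  constructor
  · intro h b hb
    ext c
    have h1 : (Finsupp.piecewise (P := p) b c).subtypeDomain p = b := by simp
    have h2 : (Finsupp.piecewise (P := p) b c).subtypeDomain (fun v ↦ ¬ p v) = c := by simp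
    have h3 := coeff_splitEquiv (p := p) f (Finsupp.piecewise (P := p) b c)
    rw [h1, h2] at h3
    rw [h3, coeff_zero]
    refine h _ (hD (fun v hv ↦ ?_) hb)
    simp [Finsupp.piecewise, hv]
  · intro h a ha
    rw [← coeff_splitEquiv (p := p), h, coeff_zero]
    refine hD (fun v hv ↦ ?_) ha
    simp [Finsupp.piecewise, hv]

theorem mem_standardIdeal_of_mul_mem {D : LowerSet (σ →₀ ℕ)} (hD : DependsOnVars p D)
    {f h : MvPolynomial σ K} (hf : f ∉ variableIdeal K p) (hfh : f * h ∈ standardIdeal K D) :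
    h ∈ standardIdeal K D := by
  rw [mem_standardIdeal_iff_splitEquiv hD] at hfh ⊢
  rw [map_mul] at hfh
  exact coeff_eq_zero_of_mul _ (mt mem_variableIdeal.2 hf) hfh

theorem exists_eq_add_C_mul {τ T : Type*} [CommRing T] (W : LowerSet (τ →₀ ℕ))
    {f g : T} (hfg : ∀ t, f ∣ g * t → f ∣ t) {H N L : MvPolynomial τ T}
    (hN : ∀ b ∈ W, coeff b N = 0) (h : C g * H = N + C f * L) :
    ∃ L', ∀ b ∈ W, coeff b (H - C f * L') = 0 := by
  classical
  have h1 (b : τ →₀ ℕ) (hb : b ∈ W) : f ∣ coeff b H := by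
    refine hfg _ ⟨coeff b L, ?_⟩
    rw [← coeff_C_mul, h, coeff_add, hN b hb, zero_add, coeff_C_mul]
  choose! t ht using h1
  refine ⟨∑ b ∈ H.support, monomial b (t b), fun b hb ↦ ?_⟩
  rw [coeff_sub, coeff_C_mul, coeff_sum]
  simp only [coeff_monomial, Finset.sum_ite_eq', mem_support_iff]
  split_ifs with h2
  · rw [← ht b hb, sub_self]
  · rw [not_not.1 h2, mul_zero, sub_zero]

theorem exists_regular_pair {D : LowerSet (σ →₀ ℕ)} (hD : DependsOnVars p D)
    {P : Ideal (MvPolynomial σ K)} [P.IsPrime] (hP : variableIdeal K p ≤ P)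
    (hne : ∀ f, P ≠ variableIdeal K p ⊔ Ideal.span {f}) :
    ∃ f ∈ P, ∃ g ∈ P, (∀ a, f * a ∈ standardIdeal K D → a ∈ standardIdeal K D) ∧
      ∀ a, g * a ∈ standardIdeal K D ⊔ Ideal.span {f} →
        a ∈ standardIdeal K D ⊔ Ideal.span {f} := by
  let ψ : MvPolynomial {v // ¬ p v} K →+* MvPolynomial σ K :=
    (splitEquiv K p).symm.toRingEquiv.toRingHom.comp C
  have hψ (t) : splitEquiv K p (ψ t) = C t := (splitEquiv K p).apply_symm_apply _
  have hmod (h : MvPolynomial σ K) : h - ψ (coeff 0 (splitEquiv K p h)) ∈ variableIdeal K p := by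
    rw [mem_variableIdeal, map_sub, hψ, coeff_sub, coeff_zero_C, sub_self]
  have hcoeff {h : MvPolynomial σ K} (hh : h ∈ P) : coeff 0 (splitEquiv K p h) ∈ P.comap ψ := by
    rw [Ideal.mem_comap]
    simpa using P.sub_mem hh (hP (hmod h))
  have hle (f : MvPolynomial {v // ¬ p v} K) (hf : P.comap ψ ≤ Ideal.span {f}) :
      P ≤ variableIdeal K p ⊔ Ideal.span {ψ f} := by
    intro h hh
    obtain ⟨t, ht⟩ := Ideal.mem_span_singleton'.1 (hf (hcoeff hh))
    rw [← sub_add_cancel h (ψ (coeff 0 (splitEquiv K p h)))]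
    refine Submodule.add_mem_sup (hmod h) ?_
    rw [← ht, map_mul]
    exact Ideal.mul_mem_left _ _ (Ideal.mem_span_singleton_self _)
  have hbot : P.comap ψ ≠ ⊥ := by
    intro h
    refine hne 0 (le_antisymm ?_ (sup_le hP (by simp)))
    simpa using hle 0 (by simp [h])
  obtain ⟨f, hf, hfp⟩ := Ideal.IsPrime.exists_mem_prime_of_ne_bot (I := P.comap ψ)
    inferInstance hbot
  obtain ⟨g, hg, hgf⟩ : ∃ g ∈ P.comap ψ, g ∉ Ideal.span {f} := by
    by_contra! h
    refine hne (ψ f) (le_antisymm (hle f h) (sup_le hP ?_))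
    rw [Ideal.span_singleton_le_iff_mem]
    exact hf
  have hdvd (t) (h : f ∣ g * t) : f ∣ t :=
    (hfp.dvd_or_dvd h).resolve_left fun h ↦ hgf (Ideal.mem_span_singleton.2 h)
  refine ⟨ψ f, hf, ψ g, hg, fun a ha ↦ mem_standardIdeal_of_mul_mem hD ?_ ha, fun a ha ↦ ?_⟩
  · rw [mem_variableIdeal, hψ, coeff_zero_C]
    exact hfp.ne_zero
  · obtain ⟨n, hn, l, hl, h⟩ := Submodule.mem_sup.1 ha
    obtain ⟨l, rfl⟩ := Ideal.mem_span_singleton'.1 hl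
    have h1 := congrArg (splitEquiv K p) h.symm
    rw [map_mul, map_add, map_mul, hψ, hψ, mul_comm _ (C f)] at h1
    obtain ⟨L, hL⟩ := exists_eq_add_C_mul _ hdvd
      ((mem_standardIdeal_iff_splitEquiv hD).1 hn) h1
    rw [← sub_add_cancel a (ψ f * (splitEquiv K p).symm L)]
    refine Submodule.add_mem_sup ((mem_standardIdeal_iff_splitEquiv hD).2 ?_)
      (Ideal.mul_mem_right _ _ (Ideal.mem_span_singleton_self _))
    rwa [map_sub, map_mul, hψ, AlgEquiv.apply_symm_apply]

end StandardMonomials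

section LocalQuotient

open IsLocalRing

/-- `φ : S → A` exhibits the local ring `A` as the localization of `S ⧸ I` at the image of the
prime ideal `P`. -/
structure IsLocalQuotient {S A : Type*} [CommRing S] [CommRing A] [IsLocalRing A]
    (I P : Ideal S) (φ : S →+* A) : Prop where
  isUnit : ∀ s ∉ P, IsUnit (φ s)
  mem_maximalIdeal : ∀ s ∈ P, φ s ∈ maximalIdeal A
  surj : ∀ a, ∃ s ∉ P, ∃ x, φ s * a = φ x
  eq_zero_iff : ∀ x, φ x = 0 ↔ ∃ s ∉ P, s * x ∈ I

theorem isLocalQuotient_algebraMap_comp_mk {S : Type*} [CommRing S] (I : Ideal S)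
    (p : Ideal (S ⧸ I)) [p.IsPrime] :
    IsLocalQuotient I (p.comap (Ideal.Quotient.mk I))
      ((algebraMap (S ⧸ I) (Localization.AtPrime p)).comp (Ideal.Quotient.mk I)) where
  isUnit s hs := IsLocalization.map_units _ (⟨_, hs⟩ : p.primeCompl)
  mem_maximalIdeal s hs :=
    (IsLocalization.AtPrime.to_map_mem_maximal_iff (Localization.AtPrime p) p _).2 hs
  surj a := by
    obtain ⟨⟨x, s⟩, h⟩ := IsLocalization.surj p.primeCompl a
    obtain ⟨x, rfl⟩ := Ideal.Quotient.mk_surjective x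
    obtain ⟨t, ht⟩ := Ideal.Quotient.mk_surjective s.1
    refine ⟨t, fun h ↦ s.2 ?_, x, ?_⟩
    · rw [← ht]
      exact h
    · rw [mul_comm, RingHom.comp_apply, RingHom.comp_apply, ht]
      exact h
  eq_zero_iff x := by
    rw [RingHom.comp_apply, IsLocalization.map_eq_zero_iff p.primeCompl]
    constructor
    · rintro ⟨s, hs⟩
      obtain ⟨t, ht⟩ := Ideal.Quotient.mk_surjective s.1
      refine ⟨t, fun h ↦ s.2 ?_, ?_⟩
      · rw [← ht]
        exact h
      · rwa [← Ideal.Quotient.eq_zero_iff_mem, map_mul, ht]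
    · rintro ⟨s, hs, h⟩
      exact ⟨⟨_, hs⟩, by rwa [← map_mul, Ideal.Quotient.eq_zero_iff_mem]⟩

theorem exists_notMem_forall {S : Type*} [CommRing S] {P : Ideal S} [P.IsPrime] {ι : Type*}
    [Finite ι] {C : ι → S → Prop} (hC : ∀ i s t, C i s → C i (t * s))
    (h : ∀ i, ∃ s ∉ P, C i s) : ∃ s ∉ P, ∀ i, C i s := by
  have := Fintype.ofFinite ι
  choose s hs hsC using h
  refine ⟨∏ i, s i, fun h ↦ ?_, fun i ↦ ?_⟩
  · obtain ⟨i, -, hi⟩ := Ideal.IsPrime.prod_mem_iff.1 h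
    exact hs i hi
  · obtain ⟨t, ht⟩ := Finset.dvd_prod_of_mem s (Finset.mem_univ i)
    rw [ht, mul_comm]
    exact hC _ _ _ (hsC i)

namespace IsLocalQuotient

variable {S A : Type*} [CommRing S] [CommRing A] [IsLocalRing A] {I P : Ideal S} {φ : S →+* A}

theorem mem_map_iff [P.IsPrime] (h : IsLocalQuotient I P φ) {J : Ideal S} (hJ : I ≤ J) {x : S} :
    φ x ∈ J.map φ ↔ ∃ s ∉ P, s * x ∈ J := by
  constructor
  · intro hx
    have key : ∀ a ∈ J.map φ, ∃ s ∉ P, ∃ y ∈ J, φ s * a = φ y := by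
      intro a ha
      refine Submodule.span_induction ?_ ?_ ?_ ?_ ha
      · rintro _ ⟨y, hy, rfl⟩
        exact ⟨1, fun h ↦ Ideal.IsPrime.ne_top' ((Ideal.eq_top_iff_one P).2 h), y, hy, by simp⟩
      · exact ⟨1, fun h ↦ Ideal.IsPrime.ne_top' ((Ideal.eq_top_iff_one P).2 h), 0, J.zero_mem,
          by simp⟩
      · rintro a b - - ⟨s, hs, y, hy, h1⟩ ⟨t, ht, z, hz, h2⟩
        refine ⟨s * t, fun h ↦ (Ideal.IsPrime.mem_or_mem ‹_› h).elim hs ht, t * y + s * z,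
          J.add_mem (J.mul_mem_left _ hy) (J.mul_mem_left _ hz), ?_⟩
        rw [map_add, map_mul, map_mul, map_mul, ← h1, ← h2]
        ring
      · rintro a b - ⟨s, hs, y, hy, h1⟩
        obtain ⟨t, ht, z, hz⟩ := h.surj a
        refine ⟨t * s, fun h ↦ (Ideal.IsPrime.mem_or_mem ‹_› h).elim ht hs, z * y,
          J.mul_mem_left _ hy, ?_⟩
        rw [map_mul, map_mul, ← h1, ← hz, smul_eq_mul]
        ring
    obtain ⟨s, hs, y, hy, h1⟩ := key _ hx
    rw [← map_mul, ← sub_eq_zero, ← map_sub, h.eq_zero_iff] at h1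
    obtain ⟨t, ht, h2⟩ := h1
    refine ⟨t * s, fun h ↦ (Ideal.IsPrime.mem_or_mem ‹_› h).elim ht hs, ?_⟩
    have h3 := J.add_mem (hJ h2) (J.mul_mem_left t hy)
    rwa [mul_sub, sub_add_cancel, ← mul_assoc] at h3
  · rintro ⟨s, hs, hsx⟩
    have h1 := Ideal.mem_map_of_mem φ hsx
    rw [map_mul] at h1
    exact (Ideal.unit_mul_mem_iff_mem _ (h.isUnit s hs)).1 h1

theorem mem_map_of_mul_mem [P.IsPrime] (h : IsLocalQuotient I P φ) {J : Ideal S} (hJ : I ≤ J)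
    {f : S} (hf : ∀ x, f * x ∈ J → x ∈ J) {a : A} (ha : φ f * a ∈ J.map φ) : a ∈ J.map φ := by
  obtain ⟨s, hs, x, hx⟩ := h.surj a
  rw [← Ideal.unit_mul_mem_iff_mem _ (h.isUnit s hs), hx, h.mem_map_iff hJ]
  have h1 : φ (f * x) ∈ J.map φ := by
    rw [map_mul, ← hx, mul_left_comm]
    exact Ideal.mul_mem_left _ _ ha
  obtain ⟨t, ht, h2⟩ := (h.mem_map_iff hJ).1 h1
  exact ⟨t, ht, hf _ (by rwa [mul_left_comm])⟩

theorem map_eq_top (h : IsLocalQuotient I P φ) {J : Ideal S} {s : S} (hs : s ∉ P) (hsJ : s ∈ J) :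
    J.map φ = ⊤ :=
  Ideal.eq_top_of_isUnit_mem _ (Ideal.mem_map_of_mem φ hsJ) (h.isUnit s hs)

theorem iInf_map_eq_bot [P.IsPrime] (h : IsLocalQuotient I P φ) {ι : Type*} [Finite ι]
    {Q : ι → Ideal S} (hQ : ⨅ i, Q i = I) : ⨅ i, (Q i).map φ = ⊥ := by
  rw [eq_bot_iff]
  intro a ha
  rw [Ideal.mem_iInf] at ha
  obtain ⟨s, hs, x, hx⟩ := h.surj a
  obtain ⟨t, ht, htx⟩ := exists_notMem_forall (P := P) (C := fun i t ↦ t * x ∈ Q i)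
    (fun i s t h ↦ by rw [mul_assoc]; exact Ideal.mul_mem_left _ _ h) fun i ↦
      (h.mem_map_iff (J := Q i) (hQ.symm.le.trans (iInf_le _ _))).1
        (hx ▸ Ideal.mul_mem_left _ _ (ha i))
  have h1 : φ x = 0 := (h.eq_zero_iff x).2 ⟨t, ht, by rwa [← hQ, Ideal.mem_iInf]⟩
  rw [← hx] at h1
  exact ((h.isUnit s hs).mul_right_eq_zero).1 h1

theorem exists_glue [P.IsPrime] (h : IsLocalQuotient I P φ) {ι : Type*} [Finite ι]
    {Q : ι → Ideal S} {Q₂ : ι → ι → Ideal S} {adj : ι → ι → Prop} (hI : ∀ i j, I ≤ Q₂ i j)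
    (hglue : ∀ e : ι → S, (∀ i j, adj i j → e i - e j ∈ Q₂ i j) → ∃ a, ∀ i, a - e i ∈ Q i)
    (e : ι → A) (he : ∀ i j, adj i j → e i - e j ∈ (Q₂ i j).map φ) :
    ∃ a, ∀ i, a - e i ∈ (Q i).map φ := by
  obtain ⟨s, hs, hse⟩ := exists_notMem_forall (P := P) (C := fun i s ↦ ∃ x, φ s * e i = φ x)
    (fun i s t ⟨x, hx⟩ ↦ ⟨t * x, by rw [map_mul, map_mul, mul_assoc, hx]⟩) fun i ↦ h.surj (e i)
  choose x hx using hse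
  obtain ⟨t, ht, htx⟩ := exists_notMem_forall (P := P) (ι := ι × ι)
    (C := fun p t ↦ adj p.1 p.2 → t * (x p.1 - x p.2) ∈ Q₂ p.1 p.2)
    (fun i s t h hij ↦ by rw [mul_assoc]; exact Ideal.mul_mem_left _ _ (h hij)) fun p ↦ by
      by_cases hp : adj p.1 p.2
      · have h1 : φ (x p.1 - x p.2) ∈ (Q₂ p.1 p.2).map φ := by
          rw [map_sub, ← hx, ← hx, ← mul_sub]
          exact Ideal.mul_mem_left _ _ (he _ _ hp)
        obtain ⟨t, ht, h2⟩ := (h.mem_map_iff (hI _ _)).1 h1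
        exact ⟨t, ht, fun _ ↦ h2⟩
      · exact ⟨1, fun h ↦ Ideal.IsPrime.ne_top' ((Ideal.eq_top_iff_one P).2 h),
          fun h ↦ (hp h).elim⟩
  obtain ⟨y, hy⟩ := hglue (fun i ↦ t * x i) fun i j hij ↦ by
    rw [← mul_sub]
    exact htx (i, j) hij
  obtain ⟨u, hu⟩ := (h.isUnit t ht).mul (h.isUnit s hs)
  refine ⟨↑u⁻¹ * φ y, fun i ↦ (Ideal.unit_mul_mem_iff_mem _ u.isUnit).1 ?_⟩
  rw [mul_sub, Units.mul_inv_cancel_left, hu, mul_assoc, hx, ← map_mul, ← map_sub]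
  exact Ideal.mem_map_of_mem φ (hy i)

end IsLocalQuotient

end LocalQuotient

section Triangulation

open MvPolynomial

/-- The facets of the triangulation of the real projective plane whose faces are the independent
sets of the graph. -/
def facet : Fin 20 → Finset (Fin 11) :=
  ![{0, 1, 5}, {0, 1, 8}, {0, 4, 5}, {0, 4, 7}, {0, 7, 8}, {1, 2, 6}, {1, 2, 8}, {1, 5, 6},
    {2, 3, 6}, {2, 3, 9}, {2, 8, 9}, {3, 4, 7}, {3, 4, 9}, {3, 6, 7}, {4, 5, 9}, {5, 6, 10},
    {5, 9, 10}, {6, 7, 10}, {7, 8, 10}, {8, 9, 10}]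

/-- Two facets are adjacent if they share a ridge. -/
abbrev FacetAdj (i j : Fin 20) : Prop := (facet i ∩ facet j).card = 2

/-- The edges of weight two. -/
def heavyEdges : List (Fin 11 × Fin 11) :=
  [(0, 2), (0, 3), (0, 6), (0, 9), (0, 10), (1, 3), (1, 4), (1, 7), (1, 9), (1, 10), (2, 4),
    (2, 5), (2, 7), (2, 10), (3, 5), (3, 8), (3, 10), (4, 6), (4, 8), (4, 10), (5, 7), (5, 8),
    (6, 8), (6, 9)]

/-- The exponents of the standard monomials of the primary component of the ideal attached to
a facet. -/
def facetExponents (i : Fin 20) : LowerSet (Fin 11 →₀ ℕ) where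
  carrier := {a | (∀ v ∉ facet i, a v < 2) ∧ (9 ∈ facet i → a 7 = 0) ∧ (7 ∈ facet i → a 9 = 0) ∧
    (a 7 = 0 ∨ a 9 = 0)}
  lower' := by
    rintro a b hab ⟨h1, h2, h3, h4⟩
    have h7 := hab 7
    have h9 := hab 9
    refine ⟨fun v hv ↦ (hab v).trans_lt (h1 v hv), fun h ↦ ?_, fun h ↦ ?_, ?_⟩
    · have := h2 h
      omega
    · have := h3 h
      omega
    · omega

theorem dependsOnVars_facetExponents (i : Fin 20) :
    DependsOnVars (· ∉ facet i) (facetExponents i) := by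
  have h79 : 7 ∉ facet i ∨ 9 ∉ facet i := by
    revert i
    decide
  rintro a b hab ⟨h1, h2, h3, h4⟩
  have h7 := hab 7
  have h9 := hab 9
  refine ⟨fun v hv ↦ (hab v hv) ▸ h1 v hv, fun h ↦ ?_, fun h ↦ ?_, ?_⟩ <;> grind

theorem dependsOnVars_facetExponents_inf (i j : Fin 20) :
    DependsOnVars (· ∉ facet i ∩ facet j) (facetExponents i ⊓ facetExponents j) := by
  rintro a b hab ⟨hi, hj⟩
  exact ⟨dependsOnVars_facetExponents i (fun v hv ↦ hab v fun h ↦ hv (Finset.mem_inter.1 h).1) hi,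
    dependsOnVars_facetExponents j (fun v hv ↦ hab v fun h ↦ hv (Finset.mem_inter.1 h).2) hj⟩

variable (K : Type u) [Field K]

/-- The primary component of the ideal attached to a facet. -/
noncomputable def facetIdeal (i : Fin 20) : Ideal (MvPolynomial (Fin 11) K) :=
  standardIdeal K (facetExponents i)

/-- The monomial ideal attached to a pair of facets. -/
noncomputable def facetPairIdeal (i j : Fin 20) : Ideal (MvPolynomial (Fin 11) K) :=
  standardIdeal K (facetExponents i ⊓ facetExponents j)

variable {K}

theorem weightedIdealGw2_le_iff {J : Ideal (MvPolynomial (Fin 11) K)} :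
    weightedIdealGw2 K ≤ J ↔ (∀ e ∈ heavyEdges, X e.1 ^ 2 * X e.2 ^ 2 ∈ J) ∧ X 7 * X 9 ∈ J := by
  simp only [weightedIdealGw2, heavyEdges, Ideal.span_le, Set.insert_subset_iff,
    Set.singleton_subset_iff, SetLike.mem_coe, List.forall_mem_cons, List.not_mem_nil,
    IsEmpty.forall_iff, forall_const, and_true, and_assoc]

theorem X_sq_mem_facetIdeal {i : Fin 20} {v : Fin 11} (hv : v ∉ facet i) :
    X v ^ 2 ∈ facetIdeal K i := by
  rw [X_pow_eq_monomial]
  refine monomial_mem_standardIdeal (fun h ↦ ?_) _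
  simpa using h.1 v hv

set_option maxRecDepth 4000 in
theorem weightedIdealGw2_le_facetIdeal (i : Fin 20) : weightedIdealGw2 K ≤ facetIdeal K i := by
  rw [weightedIdealGw2_le_iff]
  constructor
  · intro e he
    have : e.1 ∉ facet i ∨ e.2 ∉ facet i := by
      revert i e
      decide
    obtain h | h := this
    · exact Ideal.mul_mem_right _ _ (X_sq_mem_facetIdeal h)
    · exact Ideal.mul_mem_left _ _ (X_sq_mem_facetIdeal h)
  · rw [X, X, monomial_mul]
    refine monomial_mem_standardIdeal (fun h ↦ ?_) _
    simpa using h.2.2.2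

theorem facetIdeal_le_left (i j : Fin 20) : facetIdeal K i ≤ facetPairIdeal K i j :=
  standardIdeal_anti inf_le_left

theorem facetIdeal_le_right (i j : Fin 20) : facetIdeal K j ≤ facetPairIdeal K i j :=
  standardIdeal_anti inf_le_right

theorem monomial_mem_of_le {J : Ideal (MvPolynomial (Fin 11) K)} {a b : Fin 11 →₀ ℕ}
    (h : monomial b 1 ∈ J) (hab : b ≤ a) (c : K) : monomial a c ∈ J := by
  have : monomial a c = monomial (a - b) c * monomial b 1 := by
    rw [monomial_mul, mul_one, tsub_add_cancel_of_le hab]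
  rw [this]
  exact Ideal.mul_mem_left _ _ h

/-- The set with bit mask `w` is contained in a facet avoiding the vertex `u`. -/
def maskCovered (u : Fin 11) (w : ℕ) : Bool :=
  (List.finRange 20).any fun i ↦ u ∉ facet i &&
    (List.finRange 11).all fun v ↦ !w.testBit v || v ∈ facet i

/-- The set with bit mask `w` contains no edge of weight two. -/
def maskIndependent (w : ℕ) : Bool :=
  heavyEdges.all fun e ↦ !(w.testBit e.1 && w.testBit e.2)

theorem maskCovered_of_maskIndependent : (List.range 2048).all fun w ↦ !maskIndependent w ||
    ((w.testBit 7 || maskCovered 7 w) && (w.testBit 9 || maskCovered 9 w)) := by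
  decide +kernel

theorem exists_facet_of_independent {p : Fin 11 → Bool} (hp : ∀ e ∈ heavyEdges, ¬ (p e.1 ∧ p e.2))
    {u : Fin 11} (hu : u = 7 ∨ u = 9) (hpu : ¬ p u) :
    ∃ i : Fin 20, u ∉ facet i ∧ ∀ v, p v → v ∈ facet i := by
  have hbit (v : Fin 11) : (Nat.ofBits p).testBit v = p v := Nat.testBit_ofBits_lt _ _ v.2
  have key := List.all_eq_true.1 maskCovered_of_maskIndependent (Nat.ofBits p)
    (List.mem_range.2 (Nat.ofBits_lt_two_pow p))
  have hind : maskIndependent (Nat.ofBits p) := by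
    simpa [maskIndependent, hbit, ← Bool.not_eq_true, imp_iff_not_or] using hp
  have hcov : maskCovered u (Nat.ofBits p) := by
    rw [hind, Bool.not_true, Bool.false_or, Bool.and_eq_true, Bool.or_eq_true,
      Bool.or_eq_true] at key
    obtain rfl | rfl := hu
    · exact key.1.resolve_left fun h ↦ hpu ((hbit 7).symm.trans h)
    · exact key.2.resolve_left fun h ↦ hpu ((hbit 9).symm.trans h)
  simpa [maskCovered, hbit, ← Bool.not_eq_true, ← imp_iff_not_or] using hcov

theorem exists_mem_facetExponents {a : Fin 11 →₀ ℕ} (h79 : a 7 = 0 ∨ a 9 = 0)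
    (ha : ∀ e ∈ heavyEdges, ¬ (2 ≤ a e.1 ∧ 2 ≤ a e.2)) : ∃ i, a ∈ facetExponents i := by
  have key {u : Fin 11} := exists_facet_of_independent (p := fun v ↦ 2 ≤ a v)
    (by simpa using ha) (u := u)
  simp only [decide_eq_true_eq] at key
  by_cases h : a 9 = 0
  · obtain ⟨i, hi, h9⟩ := key (Or.inr rfl) (by omega)
    exact ⟨i, fun v hv ↦ by grind, by grind, by grind, by grind⟩
  · obtain ⟨i, hi, h9⟩ := key (Or.inl rfl) (by omega)
    exact ⟨i, fun v hv ↦ by grind, by grind, by grind, by grind⟩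

set_option maxRecDepth 4000 in
theorem iInf_facetIdeal : ⨅ i, facetIdeal K i = weightedIdealGw2 K := by
  refine le_antisymm (fun f hf ↦ ?_) (le_iInf weightedIdealGw2_le_facetIdeal)
  rw [Ideal.mem_iInf] at hf
  rw [f.as_sum]
  refine Ideal.sum_mem _ fun a ha ↦ ?_
  have hgen := weightedIdealGw2_le_iff.1 (le_refl (weightedIdealGw2 K))
  by_contra hmem
  obtain ⟨i, hi⟩ : ∃ i, a ∈ facetExponents i := by
    refine exists_mem_facetExponents ?_ fun e he h ↦ hmem ?_
    · by_contra! h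
      have h2 := hgen.2
      rw [X, X, monomial_mul, one_mul] at h2
      refine hmem (monomial_mem_of_le h2 (fun v ↦ ?_) _)
      simp only [Finsupp.add_apply, Finsupp.single_apply]
      grind
    · have h1 := hgen.1 e he
      have hne : e.1 ≠ e.2 := by
        clear h h1
        revert e
        decide
      rw [X_pow_eq_monomial, X_pow_eq_monomial, monomial_mul, one_mul] at h1
      refine monomial_mem_of_le h1 (fun v ↦ ?_) _
      simp only [Finsupp.add_apply, Finsupp.single_apply]
      grind
  exact mem_support_iff.1 ha (mem_standardIdeal.1 (hf i) a hi)

/-- The bit masks of the sets of facets adjacent to a given facet. -/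
def adjacencyMask : Fin 20 → ℕ :=
  ![134, 81, 16393, 2068, 262154, 448, 1058, 32801, 8736, 5376, 524864, 12296, 18944, 133376,
    69636, 196736, 573440, 303104, 655376, 328704]

theorem testBit_adjacencyMask (i j : Fin 20) (h : (adjacencyMask i).testBit j) : FacetAdj i j := by
  revert i j
  decide +kernel

/-- Enlarges the set of facets with bit mask `S` by facets in `T` adjacent to members of `S`. -/
def expandMask (T S : ℕ) : ℕ :=
  (List.finRange 20).foldl (fun S (k : Fin 20) ↦
    if S.testBit k.val then S ||| (adjacencyMask k &&& T) else S) S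

theorem forall_testBit_expandMask {C : Fin 20 → Prop} {T : ℕ}
    (hC : ∀ k l : Fin 20, T.testBit l → FacetAdj k l → C k → C l) {S : ℕ}
    (hS : ∀ k : Fin 20, S.testBit k → C k) (l : Fin 20) (hl : (expandMask T S).testBit l) :
    C l := by
  rw [expandMask] at hl
  revert hl l
  generalize List.finRange 20 = L
  induction L generalizing S with
  | nil => exact hS
  | cons k L ih =>
    rw [List.foldl_cons]
    refine ih fun l hl ↦ ?_
    split_ifs at hl with hk
    · rw [Nat.testBit_or, Nat.testBit_and, Bool.or_eq_true, Bool.and_eq_true] at hl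
      obtain hl | ⟨h1, h2⟩ := hl
      · exact hS l hl
      · exact hC k l h2 (testBit_adjacencyMask k l h1) (hS k hk)
    · exact hS l hl

/-- The bit mask of the set of facets satisfying a predicate. -/
def facetMask (p : Fin 20 → Bool) : ℕ :=
  (List.finRange 20).foldl (fun S k ↦ if p k then S ||| 1 <<< k.val else S) 0

theorem of_testBit_facetMask {p : Fin 20 → Bool} {l : Fin 20} (hl : (facetMask p).testBit l) :
    p l := by
  rw [facetMask] at hl
  have key : ∀ (L : List (Fin 20)) (S : ℕ), (∀ k : Fin 20, S.testBit k → p k) →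
      ∀ k : Fin 20, (L.foldl (fun S k ↦ if p k then S ||| 1 <<< k.val else S) S).testBit k →
        p k := by
    intro L
    induction L with
    | nil => exact fun S h ↦ h
    | cons k L ih =>
      intro S h
      rw [List.foldl_cons]
      refine ih _ fun l hl ↦ ?_
      split_ifs at hl with hk
      · rw [Nat.testBit_or, Bool.or_eq_true] at hl
        obtain hl | hl := hl
        · exact h l hl
        · rw [Nat.shiftLeft_eq, one_mul, Nat.testBit_two_pow, decide_eq_true_eq] at hl
          rwa [← Fin.ext hl]
      · exact h l hl
  exact key _ _ (by simp) l hl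

/-- The set of facets allowed in the support of a monomial: all of them, those avoiding `9`, or
those avoiding `7`. -/
def allowedFacet (q : Fin 3) (i : Fin 20) : Bool :=
  ![true, 9 ∉ facet i, 7 ∉ facet i] q

theorem testBit_expandMask_iterate : (List.finRange 3).all fun q ↦ (List.finRange 20).all fun i ↦
    (List.finRange 20).all fun j ↦ !allowedFacet q i || !allowedFacet q j ||
      ((expandMask (facetMask fun k ↦ facet i ∩ facet j ⊆ facet k && allowedFacet q k))^[4]
        (1 <<< i.val)).testBit j := by
  decide +kernel

theorem forall_of_forall_facetAdj {q : Fin 3} {i j : Fin 20} (hi : allowedFacet q i)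
    (hj : allowedFacet q j) {C : Fin 20 → Prop}
    (hC : ∀ k l : Fin 20, facet i ∩ facet j ⊆ facet l → allowedFacet q l → FacetAdj k l →
      C k → C l) (h : C i) : C j := by
  have key := testBit_expandMask_iterate
  simp only [List.all_eq_true] at key
  have := key q (List.mem_finRange q) i (List.mem_finRange i) j (List.mem_finRange j)
  rw [hi, hj, Bool.not_true, Bool.false_or, Bool.false_or] at this
  have step := Function.Iterate.rec (fun S : ℕ ↦ ∀ l : Fin 20, S.testBit l → C l) (f := expandMask
    (facetMask fun k ↦ facet i ∩ facet j ⊆ facet k && allowedFacet q k)) (a := 1 <<< i.val)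
    (fun k hk ↦ by
      rw [Nat.shiftLeft_eq, one_mul, Nat.testBit_two_pow, decide_eq_true_eq] at hk
      rwa [← Fin.ext hk])
    (fun S hS ↦ forall_testBit_expandMask (fun k l hl ↦ by
      have h1 := of_testBit_facetMask hl
      rw [Bool.and_eq_true, decide_eq_true_eq] at h1
      exact hC k l h1.1 h1.2) hS) 4
  exact step j this

theorem eq_of_mem_facetExponents {α : Type*} {a : Fin 11 →₀ ℕ} {c : Fin 20 → α}
    (hc : ∀ i j, FacetAdj i j → a ∈ facetExponents i → a ∈ facetExponents j → c i = c j)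
    {i j : Fin 20} (hi : a ∈ facetExponents i) (hj : a ∈ facetExponents j) : c i = c j := by
  obtain ⟨q, hq⟩ : ∃ q : Fin 3, ∀ k, allowedFacet q k ↔
      (9 ∈ facet k → a 7 = 0) ∧ (7 ∈ facet k → a 9 = 0) := by
    have h79 := hi.2.2.2
    by_cases h7 : a 7 = 0
    · by_cases h9 : a 9 = 0
      · exact ⟨0, fun k ↦ by simp [allowedFacet, h7, h9]⟩
      · exact ⟨2, fun k ↦ by simp [allowedFacet, h7, h9]⟩
    · have h9 : a 9 = 0 := by omega
      exact ⟨1, fun k ↦ by simp [allowedFacet, h7, h9]⟩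
  refine (forall_of_forall_facetAdj (C := fun k ↦ a ∈ facetExponents k ∧ c i = c k)
    ((hq i).2 ⟨hi.2.1, hi.2.2.1⟩) ((hq j).2 ⟨hj.2.1, hj.2.2.1⟩) (fun k l hl hql hkl hk ↦ ?_)
    ⟨hi, rfl⟩).2
  have hmem : a ∈ facetExponents l := by
    refine ⟨fun v hv ↦ ?_, ((hq l).1 hql).1, ((hq l).1 hql).2, hi.2.2.2⟩
    by_cases h : v ∈ facet i
    · exact hj.1 v fun h' ↦ hv (hl (Finset.mem_inter.2 ⟨h, h'⟩))
    · exact hi.1 v h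
  exact ⟨hmem, hk.2.trans (hc k l hkl hk.1 hmem)⟩

theorem exists_glue_facetIdeal (e : Fin 20 → MvPolynomial (Fin 11) K)
    (he : ∀ i j, FacetAdj i j → e i - e j ∈ facetPairIdeal K i j) :
    ∃ f, ∀ i, f - e i ∈ facetIdeal K i := by
  classical
  let N (a : Fin 11 →₀ ℕ) : K := if h : ∃ i, a ∈ facetExponents i then coeff a (e h.choose) else 0
  have hN (a : Fin 11 →₀ ℕ) (i : Fin 20) (hi : a ∈ facetExponents i) : N a = coeff a (e i) := by
    have h : ∃ i, a ∈ facetExponents i := ⟨i, hi⟩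
    rw [show N a = _ from dif_pos h]
    refine eq_of_mem_facetExponents (c := fun i ↦ coeff a (e i)) (fun k l hkl hk hl ↦ ?_)
      h.choose_spec hi
    rw [← sub_eq_zero, ← coeff_sub]
    exact mem_standardIdeal.1 (he k l hkl) a ⟨hk, hl⟩
  refine ⟨∑ a ∈ Finset.univ.biUnion fun i ↦ (e i).support, monomial a (N a), fun i ↦ ?_⟩
  refine mem_standardIdeal.2 fun a ha ↦ ?_
  simp only [coeff_sub, coeff_sum, coeff_monomial, Finset.sum_ite_eq', Finset.mem_biUnion,
    Finset.mem_univ, true_and, mem_support_iff]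
  rw [sub_eq_zero, ← hN a i ha, ite_eq_left_iff]
  intro h
  rw [hN a i ha]
  by_contra h'
  exact h ⟨i, Ne.symm h'⟩

end Triangulation

section Heights

open MvPolynomial

theorem idealHeight_eq_height {R : Type*} [CommRing R] (p : Ideal R) [hp : p.IsPrime] :
    idealHeight p = p.height := by
  change _ = (((⟨p, hp⟩ : PrimeSpectrum R).asIdeal.height : ℕ∞) : WithBot ℕ∞)
  rw [PrimeSpectrum.height_eq_orderHeight, Order.height_eq_krullDim_Iic]
  rfl

theorem add_le_height_of_strictMono {α β : Type*} [Preorder α] [Preorder β] {f : α → β}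
    (hf : StrictMono f) {m : ℕ} (hm : ∀ x, m ≤ Order.height (f x)) (n : ℕ) :
    ∀ x, n ≤ Order.height x → (m + n : ℕ) ≤ Order.height (f x) := by
  induction n with
  | zero => exact fun x _ ↦ hm x
  | succ n ih =>
    intro x hx
    have hlt : (n : ℕ∞) < Order.height x := lt_of_lt_of_le (by exact_mod_cast n.lt_succ_self) hx
    rw [Order.height_eq_iSup_lt_height, lt_iSup_iff] at hlt
    obtain ⟨y, hlt⟩ := hlt
    obtain ⟨hy, hlt⟩ := lt_iSup_iff.1 hlt
    have h := ih y (ENat.natCast_lt_add_one_iff.1 hlt)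
    rw [← add_assoc, Nat.cast_succ]
    exact (add_le_add_left h 1).trans (Order.height_add_one_le (hf hy))

section VariableIdeal

variable {σ K : Type*} [Field K] {p : σ → Prop}

theorem X_mem_variableIdeal {v : σ} : (X v : MvPolynomial σ K) ∈ variableIdeal K p ↔ p v := by
  classical
  rw [variableIdeal, mem_ideal_span_X_image]
  constructor
  · intro h
    obtain ⟨w, hw, hne⟩ := h (Finsupp.single v 1) (by simp)
    rwa [(Finsupp.single_apply_ne_zero.1 hne).1] at hw
  · intro hv m hm
    rw [mem_support_iff, coeff_X, ite_ne_right_iff] at hm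
    exact ⟨v, hv, by simp [← hm.1]⟩

instance isPrime_variableIdeal : (variableIdeal K p).IsPrime := by
  classical
  have : variableIdeal K p = RingHom.ker
      (constantCoeff.comp (splitEquiv K p).toRingEquiv.toRingHom) := by
    ext f
    exact mem_variableIdeal
  rw [this]
  exact RingHom.ker_isPrime _

theorem variableIdeal_mono {q : σ → Prop} (h : ∀ v, p v → q v) :
    variableIdeal K p ≤ variableIdeal K q := Ideal.span_mono (Set.image_mono h)

theorem variableIdeal_lt {q : σ → Prop} (h : ∀ v, p v → q v) {v : σ} (hv : q v) (hpv : ¬ p v) :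
    variableIdeal K p < variableIdeal K q :=
  lt_of_le_not_ge (variableIdeal_mono h) fun h ↦
    hpv (X_mem_variableIdeal.1 (h (X_mem_variableIdeal.2 hv)))

theorem card_le_height_variableIdeal (B : Finset σ) :
    B.card ≤ (variableIdeal K (· ∈ B)).height := by
  classical
  induction B using Finset.induction_on with
  | empty => simp
  | insert v B hv ih =>
    rw [Finset.card_insert_of_notMem hv, Nat.cast_succ]
    exact (add_le_add_left ih 1).trans (Ideal.height_add_one_le_of_lt_of_isPrime
      (variableIdeal_lt (fun _ ↦ Finset.mem_insert_of_mem) (Finset.mem_insert_self v B) hv))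

variable [Fintype σ] [DecidableEq σ]

theorem height_variableIdeal_sup_le (F : Finset σ) (f : MvPolynomial σ K)
    (h : variableIdeal K (· ∉ F) ⊔ Ideal.span {f} ≠ ⊤) :
    (variableIdeal K (· ∉ F) ⊔ Ideal.span {f}).height ≤ (Fᶜ.card + 1 : ℕ) := by
  refine (Ideal.height_le_spanFinrank _ h).trans (Nat.cast_le.2 ?_)
  rw [variableIdeal, ← Ideal.span_union]
  refine (Submodule.spanFinrank_span_le_ncard_of_finite (Set.toFinite _)).trans ?_
  refine (Set.ncard_union_le _ _).trans (add_le_add ?_ (Set.ncard_singleton f).le)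
  rw [← Set.ncard_coe_finset, Finset.coe_compl]
  exact Set.ncard_image_le (Set.toFinite _)

theorem height_variableIdeal (F : Finset σ) :
    (variableIdeal K (· ∉ F)).height = Fᶜ.card := by
  refine le_antisymm ((Ideal.height_le_spanFinrank _ Ideal.IsPrime.ne_top').trans
    (Nat.cast_le.2 ?_)) (by simpa using card_le_height_variableIdeal (K := K) Fᶜ)
  refine (Submodule.spanFinrank_span_le_ncard_of_finite (Set.toFinite _)).trans ?_
  rw [← Set.ncard_coe_finset, Finset.coe_compl]
  exact Set.ncard_image_le (Set.toFinite _)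

end VariableIdeal

end Heights

section LocalDepth

open MvPolynomial IsLocalRing

theorem exists_sq_notMem {σ K : Type*} [Field K] {P : Ideal (MvPolynomial σ K)} [P.IsPrime]
    {F : Finset σ} {D : LowerSet (σ →₀ ℕ)} (hFP : ¬ variableIdeal K (· ∉ F) ≤ P)
    (hX : ∀ v ∉ F, X v ^ 2 ∈ standardIdeal K D) : ∃ s ∉ P, s ∈ standardIdeal K D := by
  rw [variableIdeal, Ideal.span_le, Set.image_subset_iff, Set.not_subset] at hFP
  obtain ⟨v, hv, hvP⟩ := hFP
  exact ⟨X v ^ 2, fun h ↦ hvP (Ideal.IsPrime.mem_of_pow_mem ‹_› _ h), hX v hv⟩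

variable {σ : Type*} {K : Type u} [Field K] [Fintype σ] [DecidableEq σ] {A : Type u} [CommRing A]
  [IsLocalRing A] {I P : Ideal (MvPolynomial σ K)} {φ : MvPolynomial σ K →+* A} {F : Finset σ}
  {D : LowerSet (σ →₀ ℕ)}

theorem mem_map_standardIdeal_of_forall_mul_mem [P.IsPrime] (h : IsLocalQuotient I P φ)
    (hI : I ≤ standardIdeal K D) (hD : DependsOnVars (· ∉ F) D)
    (hX : ∀ v ∉ F, X v ^ 2 ∈ standardIdeal K D) (hP : Fᶜ.card < P.height) {a : A}
    (ha : ∀ r ∈ maximalIdeal A, r * a ∈ (standardIdeal K D).map φ) :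
    a ∈ (standardIdeal K D).map φ := by
  by_cases hFP : variableIdeal K (· ∉ F) ≤ P
  · obtain ⟨f, hf, hfF⟩ := SetLike.not_le_iff_exists.1 fun hPF : P ≤ variableIdeal K (· ∉ F) ↦
      hP.not_ge ((Ideal.height_mono hPF).trans (height_variableIdeal F).le)
    exact h.mem_map_of_mul_mem hI (fun x ↦ mem_standardIdeal_of_mul_mem hD hfF)
      (ha _ (h.mem_maximalIdeal f hf))
  · obtain ⟨s, hs, hsJ⟩ := exists_sq_notMem hFP hX
    rw [h.map_eq_top hs hsJ]
    exact Submodule.mem_top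

theorem exists_eq_mk_mul_standardIdeal [P.IsPrime] (h : IsLocalQuotient I P φ)
    (hI : I ≤ standardIdeal K D) (hD : DependsOnVars (· ∉ F) D)
    (hX : ∀ v ∉ F, X v ^ 2 ∈ standardIdeal K D) (hP : (Fᶜ.card + 1 : ℕ) < P.height)
    (ψ : maximalIdeal A →ₗ[A] A ⧸ (standardIdeal K D).map φ) :
    ∃ a : A, ∀ r, ψ r = Ideal.Quotient.mk ((standardIdeal K D).map φ) (r * a) := by
  by_cases hFP : variableIdeal K (· ∉ F) ≤ P
  · obtain ⟨f, hf, g, hg, hfQ, hgQ⟩ := exists_regular_pair hD hFP fun f hPf ↦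
      hP.not_ge (hPf ▸ height_variableIdeal_sup_le F f (hPf ▸ Ideal.IsPrime.ne_top'))
    refine exists_eq_mul_of_regular_pair (h.mem_maximalIdeal f hf) (h.mem_maximalIdeal g hg)
      (fun a ↦ h.mem_map_of_mul_mem hI hfQ) (fun a ↦ ?_) ψ
    have key := h.mem_map_of_mul_mem (hI.trans le_sup_left) hgQ (a := a)
    rwa [Ideal.map_sup, Ideal.map_span, Set.image_singleton] at key
  · obtain ⟨s, hs, hsJ⟩ := exists_sq_notMem hFP hX
    have := Ideal.Quotient.subsingleton_iff.2 (h.map_eq_top hs hsJ)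
    exact ⟨0, fun r ↦ Subsingleton.elim _ _⟩

theorem le_localRingDepth {A : Type u} [CommRing A] [IsLocalRing A] {n : ℕ}
    (h : ∀ m < n, Subsingleton (ExtMod A m (ResidueField A) A)) : n ≤ localRingDepth A := by
  refine le_sInf ?_
  rintro _ ⟨m, rfl, hm⟩
  by_contra! hlt
  exact not_subsingleton _ (h m (Nat.cast_lt.1 hlt))

theorem subsingleton_extMod_of_lt_localRingDepth {A : Type u} [CommRing A] [IsLocalRing A] {n : ℕ}
    (h : n < localRingDepth A) : Subsingleton (ExtMod A n (ResidueField A) A) := by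
  rw [← not_nontrivial_iff_subsingleton]
  exact fun hn ↦ h.not_ge (sInf_le ⟨n, rfl, hn⟩)

end LocalDepth

section Serre

open MvPolynomial IsLocalRing

variable {K : Type u} [Field K]

theorem card_compl_facet (i : Fin 20) : (facet i)ᶜ.card = 8 := by
  revert i
  decide

theorem card_compl_facet_inter {i j : Fin 20} (h : FacetAdj i j) :
    (facet i ∩ facet j)ᶜ.card = 9 := by
  rw [Finset.card_compl, h]
  rfl

theorem exists_variableIdeal_le {P : Ideal (MvPolynomial (Fin 11) K)} [hP : P.IsPrime]
    (h : weightedIdealGw2 K ≤ P) : ∃ i, variableIdeal K (· ∉ facet i) ≤ P := by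
  classical
  obtain ⟨h2, h79⟩ := weightedIdealGw2_le_iff.1 h
  have hp : ∀ e ∈ heavyEdges, ¬ (decide (X e.1 ∉ P) ∧ decide (X e.2 ∉ P)) := by
    intro e he
    rw [decide_eq_true_eq, decide_eq_true_eq, not_and_or, not_not, not_not]
    exact (hP.mem_or_mem (h2 e he)).imp (hP.mem_of_pow_mem _) (hP.mem_of_pow_mem _)
  obtain ⟨u, hu, huP⟩ : ∃ u : Fin 11, (u = 7 ∨ u = 9) ∧ (X u : MvPolynomial (Fin 11) K) ∈ P :=
    (hP.mem_or_mem h79).elim (fun h ↦ ⟨7, Or.inl rfl, h⟩) fun h ↦ ⟨9, Or.inr rfl, h⟩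
  obtain ⟨i, -, hi⟩ := exists_facet_of_independent (p := fun v ↦ decide (X v ∉ P)) hp hu
    (by simpa using huP)
  refine ⟨i, Ideal.span_le.2 ?_⟩
  rintro _ ⟨v, hv, rfl⟩
  by_contra hvP
  exact hv (hi v (decide_eq_true hvP))

theorem add_le_height_comap {p : Ideal (MvPolynomial (Fin 11) K ⧸ weightedIdealGw2 K)}
    [hp : p.IsPrime] {n : ℕ} (hn : n ≤ p.height) :
    (8 + n : ℕ) ≤ (p.comap (Ideal.Quotient.mk (weightedIdealGw2 K))).height := by
  have hmono : StrictMono (PrimeSpectrum.comap (Ideal.Quotient.mk (weightedIdealGw2 K))) :=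
    Monotone.strictMono_of_injective (fun _ _ h ↦ Ideal.comap_mono h)
      (PrimeSpectrum.comap_injective_of_surjective _ Ideal.Quotient.mk_surjective)
  have key := add_le_height_of_strictMono hmono (m := 8) (fun q ↦ ?_) n ⟨p, hp⟩
  · rw [← PrimeSpectrum.height_eq_orderHeight, ← PrimeSpectrum.height_eq_orderHeight] at key
    exact key hn
  · rw [← PrimeSpectrum.height_eq_orderHeight]
    obtain ⟨i, hi⟩ := exists_variableIdeal_le (K := K)
      (P := q.asIdeal.comap (Ideal.Quotient.mk (weightedIdealGw2 K))) (by
        intro f hf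
        rw [Ideal.mem_comap, Ideal.Quotient.eq_zero_iff_mem.2 hf]
        exact zero_mem _)
    have := Ideal.height_mono hi
    rwa [height_variableIdeal, card_compl_facet] at this

theorem X_sq_mem_facetPairIdeal {i j : Fin 20} {v : Fin 11} (hv : v ∉ facet i ∩ facet j) :
    X v ^ 2 ∈ facetPairIdeal K i j := by
  by_cases h : v ∈ facet i
  · exact facetIdeal_le_right i j (X_sq_mem_facetIdeal fun h' ↦ hv (Finset.mem_inter.2 ⟨h, h'⟩))
  · exact facetIdeal_le_left i j (X_sq_mem_facetIdeal h)

variable {A : Type u} [CommRing A] [IsLocalRing A] {P : Ideal (MvPolynomial (Fin 11) K)}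
  [P.IsPrime] {φ : MvPolynomial (Fin 11) K →+* A}

theorem subsingleton_extMod_zero_of_isLocalQuotient (h : IsLocalQuotient (weightedIdealGw2 K) P φ)
    (hP : 9 ≤ P.height) : Subsingleton (ExtMod A 0 (ResidueField A) A) := by
  refine subsingleton_extMod_zero_residueField fun x hx ↦ ?_
  rw [← Ideal.mem_bot, ← h.iInf_map_eq_bot iInf_facetIdeal, Ideal.mem_iInf]
  intro i
  refine mem_map_standardIdeal_of_forall_mul_mem h (weightedIdealGw2_le_facetIdeal i)
    (dependsOnVars_facetExponents i) (fun v ↦ X_sq_mem_facetIdeal) ?_ fun r hr ↦ ?_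
  · rw [card_compl_facet]
    exact lt_of_lt_of_le (by norm_num) hP
  · rw [hx r hr]
    exact zero_mem _

theorem exists_eq_mk_mul_facetIdeal (h : IsLocalQuotient (weightedIdealGw2 K) P φ)
    (hP : 10 ≤ P.height) (i : Fin 20) (ψ : maximalIdeal A →ₗ[A] A ⧸ (facetIdeal K i).map φ) :
    ∃ a : A, ∀ r, ψ r = Ideal.Quotient.mk ((facetIdeal K i).map φ) (r * a) := by
  refine exists_eq_mk_mul_standardIdeal h (weightedIdealGw2_le_facetIdeal i)
    (dependsOnVars_facetExponents i) (fun v ↦ X_sq_mem_facetIdeal) ?_ ψ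
  rw [card_compl_facet]
  exact lt_of_lt_of_le (by norm_num) hP

theorem mem_map_facetPairIdeal (h : IsLocalQuotient (weightedIdealGw2 K) P φ)
    (hP : 10 ≤ P.height) {i j : Fin 20} (hij : FacetAdj i j) {a : A}
    (ha : ∀ r ∈ maximalIdeal A, r * a ∈ (facetPairIdeal K i j).map φ) :
    a ∈ (facetPairIdeal K i j).map φ := by
  refine mem_map_standardIdeal_of_forall_mul_mem h
    ((weightedIdealGw2_le_facetIdeal i).trans (facetIdeal_le_left i j))
    (dependsOnVars_facetExponents_inf i j) (fun v ↦ X_sq_mem_facetPairIdeal) ?_ ha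
  rw [card_compl_facet_inter hij]
  exact lt_of_lt_of_le (by norm_num) hP

theorem subsingleton_extMod_one_of_isLocalQuotient (h : IsLocalQuotient (weightedIdealGw2 K) P φ)
    (hP : 10 ≤ P.height) : Subsingleton (ExtMod A 1 (ResidueField A) A) :=
  subsingleton_extMod_one_residueField <| exists_eq_mul_of_gluing (adj := FacetAdj)
    (Q₂ := fun i j ↦ (facetPairIdeal K i j).map φ)
    (h.iInf_map_eq_bot iInf_facetIdeal) (fun i j ↦ Ideal.map_mono (facetIdeal_le_left i j))
    (fun i j ↦ Ideal.map_mono (facetIdeal_le_right i j))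
    (h.exists_glue (fun i j ↦ (weightedIdealGw2_le_facetIdeal i).trans (facetIdeal_le_left i j))
      exists_glue_facetIdeal)
    (exists_eq_mk_mul_facetIdeal h hP) fun _ _ hij _ ↦ mem_map_facetPairIdeal h hP hij

theorem serreCondition_weightedIdealGw2 :
    SerreCondition 2 (MvPolynomial (Fin 11) K ⧸ weightedIdealGw2 K) := by
  intro p _
  have h := isLocalQuotient_algebraMap_comp_mk (weightedIdealGw2 K) p
  rw [IsLocalization.AtPrime.ringKrullDim_eq_height p]
  have h0 (hp : 1 ≤ p.height) := subsingleton_extMod_zero_of_isLocalQuotient h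
    (add_le_height_comap (n := 1) hp)
  by_cases h2 : 2 ≤ p.height
  · refine (min_le_right _ _).trans (WithBot.coe_le_coe.2 (le_localRingDepth fun m hm ↦ ?_))
    have h1 := subsingleton_extMod_one_of_isLocalQuotient h (add_le_height_comap (n := 2) h2)
    interval_cases m
    · exact h0 (le_trans (by norm_num) h2)
    · exact h1
  · refine (min_le_left _ _).trans (WithBot.coe_le_coe.2 ?_)
    by_cases h1 : 1 ≤ p.height
    · refine le_trans ?_ (le_localRingDepth (n := 1) fun m hm ↦ ?_)
      · rw [not_le] at h2
        exact ENat.lt_add_one_iff (by simp) |>.1 h2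
      · obtain rfl : m = 0 := by omega
        exact h0 h1
    · rw [Order.one_le_iff_ne_zero, not_not] at h1
      rw [h1]
      exact zero_le

end Serre

section Unmixed

open MvPolynomial

variable {K : Type u} [Field K]

theorem idealHeight_of_mem_associatedPrimes {p : Ideal (MvPolynomial (Fin 11) K)}
    (hp : p ∈ associatedPrimes _ (MvPolynomial (Fin 11) K ⧸ weightedIdealGw2 K)) :
    idealHeight p = (8 : ℕ) := by
  obtain ⟨hprime, x, hx⟩ := isAssociatedPrime_iff.1 hp
  obtain ⟨x, rfl⟩ := Ideal.Quotient.mk_surjective x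
  have hmem (f : MvPolynomial (Fin 11) K) : f ∈ p ↔ f * x ∈ weightedIdealGw2 K := by
    rw [hx, Submodule.mem_colon_singleton, Submodule.mem_bot, ← Ideal.Quotient.eq_zero_iff_mem]
    rfl
  have hle : weightedIdealGw2 K ≤ p := fun f hf ↦ (hmem f).2 (Ideal.mul_mem_right _ _ hf)
  obtain ⟨j, hj⟩ := exists_variableIdeal_le hle
  have hx' : x ∉ ⨅ i, facetIdeal K i := by
    rw [iInf_facetIdeal, ← one_mul x, ← hmem, ← Ideal.ne_top_iff_one]
    exact hprime.ne_top
  rw [Ideal.mem_iInf, not_forall] at hx'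
  obtain ⟨i, hi⟩ := hx'
  have hpi : p ≤ variableIdeal K (· ∉ facet i) := fun f hf ↦ by
    by_contra hfi
    exact hi (mem_standardIdeal_of_mul_mem (dependsOnVars_facetExponents i) hfi
      (weightedIdealGw2_le_facetIdeal i ((hmem f).1 hf)))
  have h1 := Ideal.height_mono hpi
  have h2 := Ideal.height_mono hj
  rw [height_variableIdeal, card_compl_facet] at h1 h2
  rw [idealHeight_eq_height, le_antisymm h1 h2]
  rfl

theorem isUnmixedIdeal_weightedIdealGw2 : IsUnmixedIdeal (weightedIdealGw2 K) :=
  fun _ hp _ hq ↦ (idealHeight_of_mem_associatedPrimes hp).trans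
    (idealHeight_of_mem_associatedPrimes hq).symm

end Unmixed

section NotCohenMacaulay

open MvPolynomial IsLocalRing

theorem height_map_mk_add_one_le {R : Type*} [CommRing R] {I Q Q' : Ideal R} [hQ : Q.IsPrime]
    [hQ' : Q'.IsPrime] (hI : I ≤ Q) (h : Q < Q') :
    (Q.map (Ideal.Quotient.mk I)).height + 1 ≤ (Q'.map (Ideal.Quotient.mk I)).height := by
  have := Ideal.map_isPrime_of_surjective Ideal.Quotient.mk_surjective
    (I := Q) (f := Ideal.Quotient.mk I) (by rwa [Ideal.mk_ker])
  have := Ideal.map_isPrime_of_surjective Ideal.Quotient.mk_surjective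
    (I := Q') (f := Ideal.Quotient.mk I) (by rw [Ideal.mk_ker]; exact hI.trans h.le)
  refine Ideal.height_add_one_le_of_lt_of_isPrime
    (lt_of_le_of_ne (Ideal.map_mono h.le) fun heq ↦ ?_)
  have := congrArg (Ideal.comap (Ideal.Quotient.mk I)) heq
  rw [Ideal.comap_map_mk hI, Ideal.comap_map_mk (hI.trans h.le)] at this
  exact h.ne this

/-- The exponent of the product of all variables except `X 9`. -/
noncomputable def loopExponent : Fin 11 →₀ ℕ :=
  Finsupp.equivFunOnFinite.symm fun v ↦ if v = 9 then 0 else 1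

/-- A cocycle on the pairs of adjacent facets that do not contain the vertex `9`. Its sum over the
noncontractible loop `0, 2, 3, 11, 13, 8, 5, 7, 0` of facets is `1`. -/
def loopCocycle (i j : Fin 20) : ℤ :=
  if (i, j) = (0, 2) ∨ (i, j) = (1, 4) then 1 else
    if (j, i) = (0, 2) ∨ (j, i) = (1, 4) then -1 else 0

/-- A potential for `loopCocycle` on the star of the vertex `k`. -/
def loopPotential (k : Fin 11) (i : Fin 20) : ℤ :=
  if (k, i) ∈ ([(0, 2), (0, 3), (0, 4), (5, 2), (8, 4), (8, 18)] : List (Fin 11 × Fin 20)) then -1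
  else 0

theorem loopExponent_apply (v : Fin 11) : loopExponent v = if v = 9 then 0 else 1 := rfl

theorem loopExponent_mem_facetExponents {i : Fin 20} (hi : 9 ∉ facet i) :
    loopExponent ∈ facetExponents i := by
  refine ⟨fun v _ ↦ ?_, fun h ↦ absurd h hi, fun _ ↦ rfl, Or.inr rfl⟩
  rw [loopExponent_apply]
  split_ifs <;> norm_num

theorem mem_facet_of_loopExponent_add {i : Fin 20} {k : Fin 11}
    (h : loopExponent + Finsupp.single k 1 ∈ facetExponents i) : k ∈ facet i ∧ 9 ∉ facet i := by
  obtain ⟨h1, h2, -, h4⟩ := h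
  have h7 : (loopExponent + Finsupp.single k 1 : Fin 11 →₀ ℕ) 7 ≠ 0 := by
    simp [loopExponent_apply]
  refine ⟨?_, fun h ↦ h7 (h2 h)⟩
  by_contra hk
  have := h1 k hk
  obtain rfl | hk9 := eq_or_ne k 9
  · simpa using h4.resolve_left h7
  · simp [loopExponent_apply, hk9] at this

set_option maxRecDepth 4000 in
theorem loopCocycle_eq_sub {i j : Fin 20} {k : Fin 11} (hij : FacetAdj i j) (hi : k ∈ facet i)
    (hj : k ∈ facet j) (hi9 : 9 ∉ facet i) (hj9 : 9 ∉ facet j) :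
    loopCocycle i j = loopPotential k i - loopPotential k j := by
  revert i j k
  decide +kernel

variable {K : Type u} [Field K]

variable (K) in
/-- The monomial cochain attached to `loopCocycle`. -/
noncomputable def loopCochain (i j : Fin 20) : MvPolynomial (Fin 11) K :=
  monomial loopExponent (loopCocycle i j : K)

theorem variableIdeal_true : variableIdeal K (fun _ : Fin 11 ↦ True) =
    RingHom.ker constantCoeff := by
  ext f
  rw [variableIdeal, mem_ideal_span_X_image, RingHom.mem_ker, constantCoeff_eq]
  constructor
  · intro h
    by_contra h0
    obtain ⟨v, -, hv⟩ := h 0 (mem_support_iff.2 h0)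
    exact hv rfl
  · intro h m hm
    by_contra! hv
    have : m = 0 := Finsupp.ext fun v ↦ hv v trivial
    exact mem_support_iff.1 hm (this ▸ h)

theorem exists_mul_loopCochain_sub_mem {x : MvPolynomial (Fin 11) K}
    (hx : x ∈ variableIdeal K (fun _ : Fin 11 ↦ True)) : ∃ c : Fin 20 → MvPolynomial (Fin 11) K,
      ∀ i j, FacetAdj i j → x * loopCochain K i j - (c i - c j) ∈ facetPairIdeal K i j := by
  induction hx using Submodule.span_induction with
  | mem x hx =>
    obtain ⟨k, -, rfl⟩ := hx
    refine ⟨fun i ↦ monomial (loopExponent + Finsupp.single k 1) (loopPotential k i : K),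
      fun i j hij ↦ ?_⟩
    rw [loopCochain, mul_comm, X, monomial_mul, mul_one, ← map_sub, ← map_sub]
    by_cases h : loopExponent + Finsupp.single k 1 ∈ facetExponents i ⊓ facetExponents j
    · obtain ⟨hi, hi9⟩ := mem_facet_of_loopExponent_add h.1
      obtain ⟨hj, hj9⟩ := mem_facet_of_loopExponent_add h.2
      rw [loopCocycle_eq_sub hij hi hj hi9 hj9, Int.cast_sub, sub_self, map_zero]
      exact zero_mem _
    · exact monomial_mem_standardIdeal h _
  | zero => exact ⟨0, fun i j _ ↦ by simp⟩
  | add x y _ _ hx hy =>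
    obtain ⟨c, hc⟩ := hx
    obtain ⟨d, hd⟩ := hy
    refine ⟨c + d, fun i j hij ↦ ?_⟩
    convert add_mem (hc i j hij) (hd i j hij) using 1
    simp only [Pi.add_apply]
    ring
  | smul a x _ hx =>
    obtain ⟨c, hc⟩ := hx
    refine ⟨fun i ↦ a * c i, fun i j hij ↦ ?_⟩
    convert Ideal.mul_mem_left _ a (hc i j hij) using 1
    rw [smul_eq_mul]
    ring

theorem constantCoeff_eq_zero_of_mul_loopCochain {s : MvPolynomial (Fin 11) K}
    {e : Fin 20 → MvPolynomial (Fin 11) K}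
    (h : ∀ i j, FacetAdj i j → s * loopCochain K i j - (e i - e j) ∈ facetPairIdeal K i j) :
    constantCoeff s = 0 := by
  have key (i j : Fin 20) (hij : FacetAdj i j ∧ 9 ∉ facet i ∧ 9 ∉ facet j) :
      constantCoeff s * loopCocycle i j = coeff loopExponent (e i) - coeff loopExponent (e j) := by
    have := mem_standardIdeal.1 (h i j hij.1) loopExponent
      ⟨loopExponent_mem_facetExponents hij.2.1, loopExponent_mem_facetExponents hij.2.2⟩
    rw [coeff_sub, coeff_sub, loopCochain, coeff_mul_monomial', if_pos le_rfl, tsub_self,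
      sub_eq_zero] at this
    exact this
  have h1 := key 0 2 (by decide)
  have h2 := key 2 3 (by decide)
  have h3 := key 3 11 (by decide)
  have h4 := key 11 13 (by decide)
  have h5 := key 13 8 (by decide)
  have h6 := key 8 5 (by decide)
  have h7 := key 5 7 (by decide)
  have h8 := key 7 0 (by decide)
  simp only [loopCocycle, Prod.mk.injEq, Fin.reduceEq, and_false, and_true, or_false, or_self, if_true,
    if_false, Int.cast_one, Int.cast_zero, mul_one, mul_zero] at h1 h2 h3 h4 h5 h6 h7 h8
  linear_combination h1 + h2 + h3 + h4 + h5 + h6 + h7 + h8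

variable {A : Type u} [CommRing A] [IsLocalRing A] {P : Ideal (MvPolynomial (Fin 11) K)}
  [P.IsPrime] {φ : MvPolynomial (Fin 11) K →+* A}

theorem not_subsingleton_extMod_two (h : IsLocalQuotient (weightedIdealGw2 K) P φ)
    (hP : 10 ≤ P.height) (hPX : P = variableIdeal K (fun _ : Fin 11 ↦ True)) :
    ¬ Subsingleton (ExtMod A 2 (ResidueField A) A) := by
  intro hext
  have hI (i j : Fin 20) : weightedIdealGw2 K ≤ facetPairIdeal K i j :=
    (weightedIdealGw2_le_facetIdeal i).trans (facetIdeal_le_left i j)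
  obtain ⟨e, he⟩ := exists_coboundary_of_subsingleton_extMod_two (adj := FacetAdj)
    (Q₂ := fun i j ↦ (facetPairIdeal K i j).map φ)
    (h.iInf_map_eq_bot iInf_facetIdeal) (fun i j ↦ Ideal.map_mono (facetIdeal_le_left i j))
    (fun i j ↦ Ideal.map_mono (facetIdeal_le_right i j))
    (h.exists_glue hI exists_glue_facetIdeal)
    (exists_eq_mk_mul_facetIdeal h hP) (fun _ _ hij _ ↦ mem_map_facetPairIdeal h hP hij)
    hext (fun i j ↦ φ (loopCochain K i j)) (fun r hr ↦ by
      obtain ⟨s, hs, x, hx⟩ := h.surj r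
      have hxP : x ∈ P := by
        by_contra hxP
        exact (mem_maximalIdeal _).1 (hx ▸ Ideal.mul_mem_left _ _ hr) (h.isUnit x hxP)
      obtain ⟨c, hc⟩ := exists_mul_loopCochain_sub_mem (hPX ▸ hxP)
      obtain ⟨t, ht⟩ := (h.isUnit s hs).exists_left_inv
      refine ⟨fun i ↦ t * φ (c i), fun i j hij ↦ ?_⟩
      convert Ideal.mul_mem_left _ t (Ideal.mem_map_of_mem φ (hc i j hij)) using 1
      rw [map_sub, map_mul, map_sub, ← hx]
      linear_combination (-(r * φ (loopCochain K i j))) * ht)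
  obtain ⟨s, hs, hse⟩ := exists_notMem_forall (P := P) (C := fun i s ↦ ∃ x, φ s * e i = φ x)
    (fun i s t ⟨x, hx⟩ ↦ ⟨t * x, by rw [map_mul, mul_assoc, hx, map_mul]⟩) fun i ↦ h.surj (e i)
  choose e' he' using hse
  obtain ⟨t, ht, hte⟩ := exists_notMem_forall (P := P) (C := fun (q : Fin 20 × Fin 20) t ↦
      FacetAdj q.1 q.2 → t * (s * loopCochain K q.1 q.2 - (e' q.1 - e' q.2)) ∈
        facetPairIdeal K q.1 q.2)
    (fun q t u hq hadj ↦ by rw [mul_assoc]; exact Ideal.mul_mem_left _ _ (hq hadj)) (fun q ↦ by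
      by_cases hadj : FacetAdj q.1 q.2
      · obtain ⟨t, ht, htq⟩ := (h.mem_map_iff (hI q.1 q.2)
          (x := s * loopCochain K q.1 q.2 - (e' q.1 - e' q.2))).1 (by
            convert Ideal.mul_mem_left _ (φ s) (he _ _ hadj) using 1
            rw [map_sub, map_sub, map_mul, ← he', ← he']
            ring)
        exact ⟨t, ht, fun _ ↦ htq⟩
      · exact ⟨1, Ideal.one_notMem _, fun h ↦ absurd h hadj⟩)
  have hts := constantCoeff_eq_zero_of_mul_loopCochain (s := t * s) (e := fun i ↦ t * e' i)
    fun i j hij ↦ by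
      convert hte (i, j) hij using 1
      ring
  rw [← RingHom.mem_ker, ← variableIdeal_true, ← hPX] at hts
  exact (Ideal.IsPrime.mem_or_mem ‹_› hts).elim ht hs

set_option maxRecDepth 4000 in
theorem weightedIdealGw2_le_variableIdeal (i : Fin 20) :
    weightedIdealGw2 K ≤ variableIdeal K (· ∉ facet i) := by
  have hX {v : Fin 11} (hv : v ∉ facet i) : X v ∈ variableIdeal K (· ∉ facet i) :=
    X_mem_variableIdeal.2 hv
  refine weightedIdealGw2_le_iff.2 ⟨fun e he ↦ ?_, ?_⟩
  · have : e.1 ∉ facet i ∨ e.2 ∉ facet i := by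
      clear hX
      revert i e
      decide
    exact this.elim (fun h ↦ Ideal.mul_mem_right _ _ (Ideal.pow_mem_of_mem _ (hX h) 2 two_pos))
      fun h ↦ Ideal.mul_mem_left _ _ (Ideal.pow_mem_of_mem _ (hX h) 2 two_pos)
  · have : 7 ∉ facet i ∨ 9 ∉ facet i := by
      clear hX
      revert i
      decide
    exact this.elim (fun h ↦ Ideal.mul_mem_right _ _ (hX h)) fun h ↦ Ideal.mul_mem_left _ _ (hX h)

theorem three_le_height_map_mk :
    3 ≤ ((variableIdeal K fun _ : Fin 11 ↦ True).map
      (Ideal.Quotient.mk (weightedIdealGw2 K))).height := by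
  have h1 : variableIdeal K (· ∉ facet 0) < variableIdeal K (· ∉ ({0, 1} : Finset (Fin 11))) :=
    variableIdeal_lt (by decide) (v := 5) (by decide) (by decide)
  have h2 : variableIdeal K (· ∉ ({0, 1} : Finset (Fin 11))) <
      variableIdeal K (· ∉ ({0} : Finset (Fin 11))) :=
    variableIdeal_lt (by decide) (v := 1) (by decide) (by decide)
  have h3 : variableIdeal K (· ∉ ({0} : Finset (Fin 11))) < variableIdeal K (fun _ ↦ True) :=
    variableIdeal_lt (by decide) (v := 0) (by decide) (by decide)
  have hI := weightedIdealGw2_le_variableIdeal (K := K) 0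
  have k1 := height_map_mk_add_one_le hI h1
  have k2 := height_map_mk_add_one_le (hI.trans h1.le) h2
  have k3 := height_map_mk_add_one_le (hI.trans (h1.trans h2).le) h3
  refine le_trans ?_ k3
  refine le_trans ?_ (add_le_add_left k2 1)
  refine le_trans ?_ (add_le_add_left (add_le_add_left k1 1) 1)
  rw [add_assoc, add_assoc]
  exact le_add_left (by norm_num)

theorem not_isCohenMacaulayRing_weightedIdealGw2 :
    ¬ IsCohenMacaulayRing (MvPolynomial (Fin 11) K ⧸ weightedIdealGw2 K) := by
  intro hCM
  have hker (x) (hx : x ∈ weightedIdealGw2 K) : constantCoeff x = 0 := by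
    rw [← RingHom.mem_ker, ← variableIdeal_true]
    exact variableIdeal_mono (fun _ _ ↦ trivial) (weightedIdealGw2_le_variableIdeal 0 hx)
  let p := RingHom.ker (Ideal.Quotient.lift (weightedIdealGw2 K) constantCoeff hker)
  have : p.IsMaximal := RingHom.ker_isMaximal_of_surjective _ <|
    Ideal.Quotient.lift_surjective_of_surjective _ _ fun r ↦ ⟨C r, constantCoeff_C _ r⟩
  have hcomap : p.comap (Ideal.Quotient.mk (weightedIdealGw2 K)) =
      variableIdeal K fun _ : Fin 11 ↦ True := by
    rw [variableIdeal_true]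
    rfl
  have hheight : 3 ≤ p.height := by
    rw [← Ideal.map_comap_of_surjective _ Ideal.Quotient.mk_surjective p, hcomap]
    exact three_le_height_map_mk
  have h := isLocalQuotient_algebraMap_comp_mk (weightedIdealGw2 K) p
  refine not_subsingleton_extMod_two h
    (add_le_height_comap (n := 2) (le_trans (by norm_num) hheight)) hcomap
    (subsingleton_extMod_of_lt_localRingDepth ?_)
  have key := hCM p
  rw [IsLocalization.AtPrime.ringKrullDim_eq_height p, WithBot.coe_inj] at key
  rw [key]
  exact lt_of_lt_of_le (by norm_num) hheight

end NotCohenMacaulay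

/-- Counterexample to the edge-weighted version of the conjecture of Pitones, Reyes and
Toledo: over a field `K` of characteristic `0`, the edge-weighted edge ideal `I(G_{w₂})`
of the graph coming from a triangulation of the real projective plane, with weight `1` on
the edge `x_8 x_10` and weight `2` on all other edges, is unmixed and `S/I(G_{w₂})`
satisfies Serre's condition `(S_2)`, but `S/I(G_{w₂})` is not Cohen-Macaulay. -/
theorem counterexample_Gw2 (K : Type u) [Field K] [CharZero K] :
    IsUnmixedIdeal (weightedIdealGw2 K) ∧
    SerreCondition 2 (MvPolynomial (Fin 11) K ⧸ weightedIdealGw2 K) ∧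
    ¬ IsCohenMacaulayRing (MvPolynomial (Fin 11) K ⧸ weightedIdealGw2 K) :=
  ⟨isUnmixedIdeal_weightedIdealGw2, serreCondition_weightedIdealGw2,
    not_isCohenMacaulayRing_weightedIdealGw2⟩
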